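/- Let k ≥ 1 be an integer. There exist δ > 0 and an integer n₀ > 0 such that for all integers n, r, s, t satisfying n₀ ≤ n, n+1 ≤ s ≤ t, r ≤ t ≤ 2^{δn}, and n^k ≤ t, and every unsatisfiable CNF F consisting of r clauses in n variables, every Res(k) refutation of the CNF R^kREF^F_{s,t} has length greater than 2^{β(k)·t/n^{k−1}}, where β(k) = (log₂ e)^k / (2^{k²+4k+4} · k!). -/

import Mathlib

open Classical Finset

structure Lit (V : Type) where
  var : V
  pos : Bool
deriving DecidableEq

abbrev Clause (V : Type) := Finset (Lit V)
abbrev PTerm (V : Type) := Finset (Lit V)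
abbrev Cnf (V : Type) := Finset (Clause V)
abbrev Dnf (V : Type) := Finset (PTerm V)

variable {V : Type} [DecidableEq V]

def Lit.neg (l : Lit V) : Lit V := ⟨l.var, !l.pos⟩

/-- A clause viewed as a 1-DNF. -/
def clauseToDnf (C : Clause V) : Dnf V := C.image (fun l => {l})

/-- A `k`-DNF: every term has at most `k` literals. -/
def IsKDnf (k : ℕ) (G : Dnf V) : Prop := ∀ q ∈ G, q.card ≤ k

/-- The inference rules of Res(k): axiom, weakening, ∧-introduction and cut. -/
inductive ResKInf (k : ℕ) : List (Dnf V) → Dnf V → Prop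
  | ax (x : V) :
      ResKInf k [] {{(⟨x, true⟩ : Lit V)}, {(⟨x, false⟩ : Lit V)}}
  | weaken (A B : Dnf V) : ResKInf k [A] (A ∪ B)
  | andIntro (A B : Dnf V) (l : Lit V) (q : PTerm V) (hq : q.card + 1 ≤ k) :
      ResKInf k [A ∪ {({l} : PTerm V)}, B ∪ {q}] (A ∪ B ∪ {insert l q})
  | cut (A B : Dnf V) (q : PTerm V) :
      ResKInf k [A ∪ {q}, B ∪ q.image (fun l => ({l.neg} : PTerm V))] (A ∪ B)

/-- A Res(k) refutation of the CNF `F`: a sequence of k-DNFs, each a clause of `F`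
or inferred from earlier lines, ending with the empty clause. -/
def IsResKRefutation (k : ℕ) (F : Set (Clause V)) (P : List (Dnf V)) : Prop :=
  P ≠ [] ∧ P.getLast? = some (∅ : Dnf V) ∧ (∀ G ∈ P, IsKDnf k G) ∧
  ∀ i : Fin P.length,
    (∃ C ∈ F, P.get i = clauseToDnf C) ∨
    ∃ prems : List (Dnf V), ResKInf k prems (P.get i) ∧
      ∀ Q ∈ prems, ∃ j : Fin P.length, (j : ℕ) < (i : ℕ) ∧ P.get j = Q

/-- The number of symbols in a DNF. -/
def dnfSize (G : Dnf V) : ℕ := ∑ q ∈ G, (q.card + 1)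

/-- The size (number of symbols) of a Res(k) refutation. -/
def proofSize (P : List (Dnf V)) : ℕ := (P.map dnfSize).sum

/-- The size (number of symbols) of a CNF. -/
def cnfSize (F : Cnf V) : ℕ := ∑ C ∈ F, (C.card + 1)

/-- The set of propositional variables occurring in a CNF. -/
def cnfVars (F : Cnf V) : Finset V := F.sup (fun C => C.image Lit.var)

def SatClauseA (a : V → Bool) (C : Clause V) : Prop := ∃ l ∈ C, a l.var = l.pos

/-- Unsatisfiability of a CNF. -/
def Unsat (F : Set (Clause V)) : Prop := ¬ ∃ a : V → Bool, ∀ C ∈ F, SatClauseA a C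

def litSatP (π : V → Option Bool) (l : Lit V) : Prop := π l.var = some l.pos
def litFalsP (π : V → Option Bool) (l : Lit V) : Prop := π l.var = some (!l.pos)

/-- A partial assignment satisfies a term if it satisfies all its literals. -/
def satPTerm (π : V → Option Bool) (q : PTerm V) : Prop := ∀ l ∈ q, litSatP π l
/-- A partial assignment falsifies a term if it falsifies some literal of it. -/
def falsPTerm (π : V → Option Bool) (q : PTerm V) : Prop := ∃ l ∈ q, litFalsP π l

/-- The restriction of a DNF by a partial assignment: falsified terms are removed,
and satisfied literals are removed from the remaining terms. -/
noncomputable def restrictDnf (G : Dnf V) (π : V → Option Bool) : Dnf V :=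
  (G.filter (fun q => ¬ falsPTerm π q)).image (fun q => q.filter (fun l => ¬ litSatP π l))

def clauseSatP (π : V → Option Bool) (C : Clause V) : Prop := ∃ l ∈ C, litSatP π l

/-- The restriction of a clause: falsified literals are removed. -/
noncomputable def restrictClause (C : Clause V) (π : V → Option Bool) : Clause V :=
  C.filter (fun l => ¬ litFalsP π l)

/-- The restriction of a CNF by a partial assignment: satisfied clauses are removed,
falsified literals are removed from the remaining clauses. -/
def restrictCnfSet (F : Set (Clause V)) (π : V → Option Bool) : Set (Clause V) :=
  {E | ∃ C ∈ F, ¬ clauseSatP π C ∧ E = restrictClause C π}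

/-- A resolution refutation of the CNF `F` (weakening is built into the rules). -/
def IsResRefutation (F : Set (Clause V)) (P : List (Clause V)) : Prop :=
  P ≠ [] ∧ P.getLast? = some (∅ : Clause V) ∧
  ∀ i : Fin P.length,
    (∃ C ∈ F, C ⊆ P.get i) ∨
    ∃ jv jw : Fin P.length, (jv : ℕ) < (i : ℕ) ∧ (jw : ℕ) < (i : ℕ) ∧ ∃ x : V,
      (⟨x, true⟩ : Lit V) ∈ P.get jv ∧ (⟨x, false⟩ : Lit V) ∈ P.get jw ∧
      ((P.get jv).erase ⟨x, true⟩ ∪ (P.get jw).erase ⟨x, false⟩) ⊆ P.get i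

/-- The variables of the formula `REF^F_{s,t}`. -/
inductive RefVar : Type
  | D (i j ℓ : ℕ) (b : Bool)
  | L (i j j' : ℕ)
  | R (i j j' : ℕ)
  | V (i j ℓ : ℕ)
  | I (j m : ℕ)
deriving DecidableEq

/-- The home pair of a variable of `REF^F_{s,t}`. -/
def RefVar.homePair : RefVar → ℕ × ℕ
  | .D i j _ _ => (i, j)
  | .L i j _ => (i, j)
  | .R i j _ => (i, j)
  | .V i j _ => (i, j)
  | .I j _ => (1, j)

/-- The variable is one of the variables of `REF^F_{s,t}` (indices in range). -/
def RefVar.valid (n r s t : ℕ) : RefVar → Prop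
  | .D i j ℓ _ => i ∈ Finset.Icc 1 s ∧ j ∈ Finset.Icc 1 t ∧ ℓ ∈ Finset.Icc 1 n
  | .L i j j' => i ∈ Finset.Icc 2 s ∧ j ∈ Finset.Icc 1 t ∧ j' ∈ Finset.Icc 1 t
  | .R i j j' => i ∈ Finset.Icc 2 s ∧ j ∈ Finset.Icc 1 t ∧ j' ∈ Finset.Icc 1 t
  | .V i j ℓ => i ∈ Finset.Icc 2 s ∧ j ∈ Finset.Icc 1 t ∧ ℓ ∈ Finset.Icc 1 n
  | .I j m => j ∈ Finset.Icc 1 t ∧ m ∈ Finset.Icc 1 r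

/-- The clauses of `REF^F_{s,t}`, where `F` has the `r` clauses `Cm 1, …, Cm r` in the
`n` variables `x_1, …, x_n` (a variable of `F` is represented by its index in `[n]`). -/
inductive RefClause (Cm : ℕ → Clause ℕ) (n r s t : ℕ) : Clause RefVar → Prop
  | ax {j m ℓ : ℕ} {b : Bool} (hj : j ∈ Finset.Icc 1 t) (hm : m ∈ Finset.Icc 1 r)
      (hℓ : ℓ ∈ Finset.Icc 1 n) (hmem : (⟨ℓ, b⟩ : Lit ℕ) ∈ Cm m) :
      RefClause Cm n r s t {⟨.I j m, false⟩, ⟨.D 1 j ℓ b, true⟩}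
  | nontaut {i j ℓ : ℕ} (hi : i ∈ Finset.Icc 1 s) (hj : j ∈ Finset.Icc 1 t)
      (hℓ : ℓ ∈ Finset.Icc 1 n) :
      RefClause Cm n r s t {⟨.D i j ℓ true, false⟩, ⟨.D i j ℓ false, false⟩}
  | lcut {i j j' ℓ : ℕ} (hi : i ∈ Finset.Icc 2 s) (hj : j ∈ Finset.Icc 1 t)
      (hj' : j' ∈ Finset.Icc 1 t) (hℓ : ℓ ∈ Finset.Icc 1 n) :
      RefClause Cm n r s t {⟨.L i j j', false⟩, ⟨.V i j ℓ, false⟩, ⟨.D (i-1) j' ℓ true, true⟩}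
  | rcut {i j j' ℓ : ℕ} (hi : i ∈ Finset.Icc 2 s) (hj : j ∈ Finset.Icc 1 t)
      (hj' : j' ∈ Finset.Icc 1 t) (hℓ : ℓ ∈ Finset.Icc 1 n) :
      RefClause Cm n r s t {⟨.R i j j', false⟩, ⟨.V i j ℓ, false⟩, ⟨.D (i-1) j' ℓ false, true⟩}
  | ltransf {i j j' ℓ ℓ' : ℕ} {b : Bool} (hi : i ∈ Finset.Icc 2 s) (hj : j ∈ Finset.Icc 1 t)
      (hj' : j' ∈ Finset.Icc 1 t) (hℓ : ℓ ∈ Finset.Icc 1 n) (hℓ' : ℓ' ∈ Finset.Icc 1 n)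
      (hne : (ℓ', b) ≠ (ℓ, true)) :
      RefClause Cm n r s t
        {⟨.L i j j', false⟩, ⟨.V i j ℓ, false⟩, ⟨.D (i-1) j' ℓ' b, false⟩, ⟨.D i j ℓ' b, true⟩}
  | rtransf {i j j' ℓ ℓ' : ℕ} {b : Bool} (hi : i ∈ Finset.Icc 2 s) (hj : j ∈ Finset.Icc 1 t)
      (hj' : j' ∈ Finset.Icc 1 t) (hℓ : ℓ ∈ Finset.Icc 1 n) (hℓ' : ℓ' ∈ Finset.Icc 1 n)
      (hne : (ℓ', b) ≠ (ℓ, false)) :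
      RefClause Cm n r s t
        {⟨.R i j j', false⟩, ⟨.V i j ℓ, false⟩, ⟨.D (i-1) j' ℓ' b, false⟩, ⟨.D i j ℓ' b, true⟩}
  | empty {ℓ : ℕ} {b : Bool} (hℓ : ℓ ∈ Finset.Icc 1 n) :
      RefClause Cm n r s t {⟨.D s t ℓ b, false⟩}
  | vdom {i j : ℕ} (hi : i ∈ Finset.Icc 2 s) (hj : j ∈ Finset.Icc 1 t) :
      RefClause Cm n r s t ((Finset.Icc 1 n).image (fun ℓ => (⟨.V i j ℓ, true⟩ : Lit RefVar)))
  | idom {j : ℕ} (hj : j ∈ Finset.Icc 1 t) :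
      RefClause Cm n r s t ((Finset.Icc 1 r).image (fun m => (⟨.I j m, true⟩ : Lit RefVar)))
  | ldom {i j : ℕ} (hi : i ∈ Finset.Icc 2 s) (hj : j ∈ Finset.Icc 1 t) :
      RefClause Cm n r s t ((Finset.Icc 1 t).image (fun j' => (⟨.L i j j', true⟩ : Lit RefVar)))
  | rdom {i j : ℕ} (hi : i ∈ Finset.Icc 2 s) (hj : j ∈ Finset.Icc 1 t) :
      RefClause Cm n r s t ((Finset.Icc 1 t).image (fun j' => (⟨.R i j j', true⟩ : Lit RefVar)))
  | vfunc {i j ℓ ℓ' : ℕ} (hi : i ∈ Finset.Icc 2 s) (hj : j ∈ Finset.Icc 1 t)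
      (hℓ : ℓ ∈ Finset.Icc 1 n) (hℓ' : ℓ' ∈ Finset.Icc 1 n) (hne : ℓ ≠ ℓ') :
      RefClause Cm n r s t {⟨.V i j ℓ, false⟩, ⟨.V i j ℓ', false⟩}
  | ifunc {j m m' : ℕ} (hj : j ∈ Finset.Icc 1 t) (hm : m ∈ Finset.Icc 1 r)
      (hm' : m' ∈ Finset.Icc 1 r) (hne : m ≠ m') :
      RefClause Cm n r s t {⟨.I j m, false⟩, ⟨.I j m', false⟩}
  | lfunc {i j j' j'' : ℕ} (hi : i ∈ Finset.Icc 2 s) (hj : j ∈ Finset.Icc 1 t)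
      (hj' : j' ∈ Finset.Icc 1 t) (hj'' : j'' ∈ Finset.Icc 1 t) (hne : j' ≠ j'') :
      RefClause Cm n r s t {⟨.L i j j', false⟩, ⟨.L i j j'', false⟩}
  | rfunc {i j j' j'' : ℕ} (hi : i ∈ Finset.Icc 2 s) (hj : j ∈ Finset.Icc 1 t)
      (hj' : j' ∈ Finset.Icc 1 t) (hj'' : j'' ∈ Finset.Icc 1 t) (hne : j' ≠ j'') :
      RefClause Cm n r s t {⟨.R i j j', false⟩, ⟨.R i j j'', false⟩}

/-- The number of home pairs mentioned in a clause in the variables of `REF^F_{s,t}`. -/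
def indexWidth (E : Clause RefVar) : ℕ := (E.image (fun l => l.var.homePair)).card

/-- The variables of the relativized formula `R^kREF^F_{s,t}`: the variables of
`REF^F_{s,t}` together with the selector variables `S u i j`. -/
inductive RRefVar : Type
  | base (v : RefVar)
  | S (u i j : ℕ)
deriving DecidableEq

/-- The home pair of a variable of `R^kREF^F_{s,t}`. -/
def RRefVar.homePair : RRefVar → ℕ × ℕ
  | .base v => v.homePair
  | .S _ i j => (i, j)

/-- The disjunction `⋁_{u ∈ [k]} ¬S_u(i,j)`. -/
def Sneg (k i j : ℕ) : Clause RRefVar :=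
  (Finset.Icc 1 k).image (fun u => (⟨.S u i j, false⟩ : Lit RRefVar))

/-- The clauses of `R^kREF^F_{s,t}`: the clauses of `REF^F_{s,t}` with the disjunction
`⋁_{u∈[k]} ¬S_u(i,j)` added for the corresponding home pair `(i,j)`, the unit clauses
`S_u(s,t)`, and the clauses forbidding the use of unselected premises. -/
inductive RRefClause (Cm : ℕ → Clause ℕ) (n r s t k : ℕ) : Clause RRefVar → Prop
  | ax {j m ℓ : ℕ} {b : Bool} (hj : j ∈ Finset.Icc 1 t) (hm : m ∈ Finset.Icc 1 r)
      (hℓ : ℓ ∈ Finset.Icc 1 n) (hmem : (⟨ℓ, b⟩ : Lit ℕ) ∈ Cm m) :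
      RRefClause Cm n r s t k
        (Sneg k 1 j ∪ {⟨.base (.I j m), false⟩, ⟨.base (.D 1 j ℓ b), true⟩})
  | nontaut {i j ℓ : ℕ} (hi : i ∈ Finset.Icc 1 s) (hj : j ∈ Finset.Icc 1 t)
      (hℓ : ℓ ∈ Finset.Icc 1 n) :
      RRefClause Cm n r s t k
        (Sneg k i j ∪ {⟨.base (.D i j ℓ true), false⟩, ⟨.base (.D i j ℓ false), false⟩})
  | lcut {i j j' ℓ : ℕ} (hi : i ∈ Finset.Icc 2 s) (hj : j ∈ Finset.Icc 1 t)
      (hj' : j' ∈ Finset.Icc 1 t) (hℓ : ℓ ∈ Finset.Icc 1 n) :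
      RRefClause Cm n r s t k
        (Sneg k i j ∪ {⟨.base (.L i j j'), false⟩, ⟨.base (.V i j ℓ), false⟩,
          ⟨.base (.D (i-1) j' ℓ true), true⟩})
  | rcut {i j j' ℓ : ℕ} (hi : i ∈ Finset.Icc 2 s) (hj : j ∈ Finset.Icc 1 t)
      (hj' : j' ∈ Finset.Icc 1 t) (hℓ : ℓ ∈ Finset.Icc 1 n) :
      RRefClause Cm n r s t k
        (Sneg k i j ∪ {⟨.base (.R i j j'), false⟩, ⟨.base (.V i j ℓ), false⟩,
          ⟨.base (.D (i-1) j' ℓ false), true⟩})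
  | ltransf {i j j' ℓ ℓ' : ℕ} {b : Bool} (hi : i ∈ Finset.Icc 2 s) (hj : j ∈ Finset.Icc 1 t)
      (hj' : j' ∈ Finset.Icc 1 t) (hℓ : ℓ ∈ Finset.Icc 1 n) (hℓ' : ℓ' ∈ Finset.Icc 1 n)
      (hne : (ℓ', b) ≠ (ℓ, true)) :
      RRefClause Cm n r s t k
        (Sneg k i j ∪ {⟨.base (.L i j j'), false⟩, ⟨.base (.V i j ℓ), false⟩,
          ⟨.base (.D (i-1) j' ℓ' b), false⟩, ⟨.base (.D i j ℓ' b), true⟩})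
  | rtransf {i j j' ℓ ℓ' : ℕ} {b : Bool} (hi : i ∈ Finset.Icc 2 s) (hj : j ∈ Finset.Icc 1 t)
      (hj' : j' ∈ Finset.Icc 1 t) (hℓ : ℓ ∈ Finset.Icc 1 n) (hℓ' : ℓ' ∈ Finset.Icc 1 n)
      (hne : (ℓ', b) ≠ (ℓ, false)) :
      RRefClause Cm n r s t k
        (Sneg k i j ∪ {⟨.base (.R i j j'), false⟩, ⟨.base (.V i j ℓ), false⟩,
          ⟨.base (.D (i-1) j' ℓ' b), false⟩, ⟨.base (.D i j ℓ' b), true⟩})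
  | empty {ℓ : ℕ} {b : Bool} (hℓ : ℓ ∈ Finset.Icc 1 n) :
      RRefClause Cm n r s t k (Sneg k s t ∪ {⟨.base (.D s t ℓ b), false⟩})
  | vdom {i j : ℕ} (hi : i ∈ Finset.Icc 2 s) (hj : j ∈ Finset.Icc 1 t) :
      RRefClause Cm n r s t k
        (Sneg k i j ∪ (Finset.Icc 1 n).image (fun ℓ => (⟨.base (.V i j ℓ), true⟩ : Lit RRefVar)))
  | idom {j : ℕ} (hj : j ∈ Finset.Icc 1 t) :
      RRefClause Cm n r s t k
        (Sneg k 1 j ∪ (Finset.Icc 1 r).image (fun m => (⟨.base (.I j m), true⟩ : Lit RRefVar)))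
  | ldom {i j : ℕ} (hi : i ∈ Finset.Icc 2 s) (hj : j ∈ Finset.Icc 1 t) :
      RRefClause Cm n r s t k
        (Sneg k i j ∪ (Finset.Icc 1 t).image (fun j' => (⟨.base (.L i j j'), true⟩ : Lit RRefVar)))
  | rdom {i j : ℕ} (hi : i ∈ Finset.Icc 2 s) (hj : j ∈ Finset.Icc 1 t) :
      RRefClause Cm n r s t k
        (Sneg k i j ∪ (Finset.Icc 1 t).image (fun j' => (⟨.base (.R i j j'), true⟩ : Lit RRefVar)))
  | vfunc {i j ℓ ℓ' : ℕ} (hi : i ∈ Finset.Icc 2 s) (hj : j ∈ Finset.Icc 1 t)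
      (hℓ : ℓ ∈ Finset.Icc 1 n) (hℓ' : ℓ' ∈ Finset.Icc 1 n) (hne : ℓ ≠ ℓ') :
      RRefClause Cm n r s t k
        (Sneg k i j ∪ {⟨.base (.V i j ℓ), false⟩, ⟨.base (.V i j ℓ'), false⟩})
  | ifunc {j m m' : ℕ} (hj : j ∈ Finset.Icc 1 t) (hm : m ∈ Finset.Icc 1 r)
      (hm' : m' ∈ Finset.Icc 1 r) (hne : m ≠ m') :
      RRefClause Cm n r s t k
        (Sneg k 1 j ∪ {⟨.base (.I j m), false⟩, ⟨.base (.I j m'), false⟩})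
  | lfunc {i j j' j'' : ℕ} (hi : i ∈ Finset.Icc 2 s) (hj : j ∈ Finset.Icc 1 t)
      (hj' : j' ∈ Finset.Icc 1 t) (hj'' : j'' ∈ Finset.Icc 1 t) (hne : j' ≠ j'') :
      RRefClause Cm n r s t k
        (Sneg k i j ∪ {⟨.base (.L i j j'), false⟩, ⟨.base (.L i j j''), false⟩})
  | rfunc {i j j' j'' : ℕ} (hi : i ∈ Finset.Icc 2 s) (hj : j ∈ Finset.Icc 1 t)
      (hj' : j' ∈ Finset.Icc 1 t) (hj'' : j'' ∈ Finset.Icc 1 t) (hne : j' ≠ j'') :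
      RRefClause Cm n r s t k
        (Sneg k i j ∪ {⟨.base (.R i j j'), false⟩, ⟨.base (.R i j j''), false⟩})
  | sTrue {u : ℕ} (hu : u ∈ Finset.Icc 1 k) :
      RRefClause Cm n r s t k {⟨.S u s t, true⟩}
  | lUnused {i j j' u' : ℕ} (hi : i ∈ Finset.Icc 2 s) (hj : j ∈ Finset.Icc 1 t)
      (hj' : j' ∈ Finset.Icc 1 t) (hu' : u' ∈ Finset.Icc 1 k) :
      RRefClause Cm n r s t k
        (Sneg k i j ∪ {⟨.base (.L i j j'), false⟩, ⟨.S u' (i-1) j', true⟩})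
  | rUnused {i j j' u' : ℕ} (hi : i ∈ Finset.Icc 2 s) (hj : j ∈ Finset.Icc 1 t)
      (hj' : j' ∈ Finset.Icc 1 t) (hu' : u' ∈ Finset.Icc 1 k) :
      RRefClause Cm n r s t k
        (Sneg k i j ∪ {⟨.base (.R i j j'), false⟩, ⟨.S u' (i-1) j', true⟩})

/-- `β(k) = (log₂ e)^k / (2^{k²+4k+4}·k!)`. -/
noncomputable def betaConst (k : ℕ) : ℝ :=
  (Real.logb 2 (Real.exp 1)) ^ k / (2 ^ (k ^ 2 + 4 * k + 4) * (Nat.factorial k))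

set_option linter.unusedSectionVars false

/-! ### Averages over the subsets of a finite set -/

/-- The average of `f` over all subsets of `W`. -/
noncomputable def avg (W : Finset V) (f : Finset V → ℝ) : ℝ :=
  (∑ A ∈ W.powerset, f A) / 2 ^ W.card

/-- The indicator of a proposition. -/
noncomputable def ind (p : Prop) : ℝ := if p then 1 else 0

lemma ind_true {p : Prop} (h : p) : ind p = 1 := if_pos h

lemma ind_false {p : Prop} (h : ¬ p) : ind p = 0 := if_neg h

lemma ind_nonneg (p : Prop) : 0 ≤ ind p := by
  unfold ind
  split_ifs <;> norm_num

lemma ind_le_ind {p q : Prop} (h : p → q) : ind p ≤ ind q := by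
  by_cases hp : p
  · rw [ind_true hp, ind_true (h hp)]
  · rw [ind_false hp]
    exact ind_nonneg q

lemma ind_forall {ι : Type*} (I : Finset ι) (p : ι → Prop) :
    ind (∀ i ∈ I, p i) = ∏ i ∈ I, ind (p i) := by
  by_cases h : ∀ i ∈ I, p i
  · rw [ind_true h]
    exact (prod_eq_one fun v hv => ind_true (h v hv)).symm
  · rw [ind_false h]
    push Not at h
    obtain ⟨v, hv, hne⟩ := h
    exact (prod_eq_zero hv (ind_false hne)).symm

/-- The probability of `E` for a uniformly random subset of `W`. -/
noncomputable def pr (W : Finset V) (E : Finset V → Prop) : ℝ :=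
  avg W (fun A => ind (E A))

/-- The set that agrees with `A` on `Q` and with `B` off `Q`. -/
noncomputable def mix (Q : Set V) (A B : Finset V) : Finset V :=
  A.filter (· ∈ Q) ∪ B.filter (· ∉ Q)

lemma mem_mix_of_mem {Q : Set V} {A B : Finset V} {v : V} (h : v ∈ Q) :
    v ∈ mix Q A B ↔ v ∈ A := by
  simp [mix, h]

lemma mem_mix_of_notMem {Q : Set V} {A B : Finset V} {v : V} (h : v ∉ Q) :
    v ∈ mix Q A B ↔ v ∈ B := by
  simp [mix, h]

lemma mix_subset {Q : Set V} {A B W : Finset V} (hA : A ⊆ W) (hB : B ⊆ W) : mix Q A B ⊆ W := by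
  intro v hv
  by_cases h : v ∈ Q
  · exact hA ((mem_mix_of_mem h).1 hv)
  · exact hB ((mem_mix_of_notMem h).1 hv)

lemma mix_mix_swap (Q : Set V) (A B : Finset V) : mix Q (mix Q A B) (mix Q B A) = A := by
  ext v
  by_cases h : v ∈ Q <;> simp [mix, h]

lemma avg_mono {W : Finset V} {f g : Finset V → ℝ} (h : ∀ A ⊆ W, f A ≤ g A) :
    avg W f ≤ avg W g := by
  unfold avg
  gcongr with A hA
  exact h A (mem_powerset.1 hA)

lemma avg_const (W : Finset V) (c : ℝ) : avg W (fun _ => c) = c := by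
  simp [avg]

lemma avg_mul_left (W : Finset V) (c : ℝ) (f : Finset V → ℝ) :
    avg W (fun A => c * f A) = c * avg W f := by
  simp only [avg, ← mul_sum, mul_div_assoc]

lemma avg_mul_right (W : Finset V) (c : ℝ) (f : Finset V → ℝ) :
    avg W (fun A => f A * c) = avg W f * c := by
  simp only [avg, ← sum_mul]
  ring

lemma avg_sub (W : Finset V) (f g : Finset V → ℝ) :
    avg W (fun A => f A - g A) = avg W f - avg W g := by
  simp only [avg, sum_sub_distrib, sub_div]

lemma avg_sum {ι : Type*} (W : Finset V) (I : Finset ι) (f : ι → Finset V → ℝ) :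
    avg W (fun A => ∑ i ∈ I, f i A) = ∑ i ∈ I, avg W (f i) := by
  simp only [avg, sum_div]
  rw [sum_comm]

lemma avg_mix (W : Finset V) (Q : Set V) (f : Finset V → ℝ) :
    avg W f = avg W (fun A => avg W (fun B => f (mix Q A B))) := by
  have key : ∑ A ∈ W.powerset, ∑ B ∈ W.powerset, f (mix Q A B)
      = ∑ A ∈ W.powerset, ∑ _B ∈ W.powerset, f A := by
    rw [← sum_product', ← sum_product']
    refine sum_nbij' (fun x => (mix Q x.1 x.2, mix Q x.2 x.1))
      (fun x => (mix Q x.1 x.2, mix Q x.2 x.1)) ?_ ?_ ?_ ?_ ?_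
    · rintro ⟨A, B⟩ h
      simp only [mem_product, mem_powerset] at h ⊢
      exact ⟨mix_subset h.1 h.2, mix_subset h.2 h.1⟩
    · rintro ⟨A, B⟩ h
      simp only [mem_product, mem_powerset] at h ⊢
      exact ⟨mix_subset h.1 h.2, mix_subset h.2 h.1⟩
    · rintro ⟨A, B⟩ -
      simp only [mix_mix_swap]
    · rintro ⟨A, B⟩ -
      simp only [mix_mix_swap]
    · rintro ⟨A, B⟩ -
      rfl
  simp only [avg, ← sum_div]
  rw [key]
  simp only [sum_const, card_powerset, nsmul_eq_mul, ← mul_sum]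
  push_cast
  field_simp

lemma avg_le_of_mix_le {W : Finset V} {c : ℝ} (Q : Set V) {f : Finset V → ℝ}
    (h : ∀ A, avg W (fun B => f (mix Q A B)) ≤ c) : avg W f ≤ c := by
  rw [avg_mix W Q f, ← avg_const W c]
  exact avg_mono fun A _ => h A

lemma avg_mul_of_indep {W : Finset V} {f g : Finset V → ℝ} (Q : Set V)
    (hf : ∀ A B, f (mix Q A B) = f A) (hg : ∀ A B, g (mix Q A B) = g B) :
    avg W (fun A => f A * g A) = avg W f * avg W g := by
  rw [avg_mix W Q]
  simp only [hf, hg, avg_mul_left, avg_mul_right]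

lemma avg_prod {ι : Type*} {W : Finset V} (I : Finset ι) (b : ι → Set V) (g : ι → Finset V → ℝ)
    (hb : ∀ i ∈ I, ∀ i' ∈ I, i ≠ i' → Disjoint (b i) (b i'))
    (hg : ∀ i ∈ I, ∀ A B : Finset V, (∀ v ∈ b i, (v ∈ A ↔ v ∈ B)) → g i A = g i B) :
    avg W (fun A => ∏ i ∈ I, g i A) = ∏ i ∈ I, avg W (g i) := by
  induction I using Finset.induction_on with
  | empty => simp [avg_const]
  | insert i I hi ih =>
    simp only [prod_insert hi]
    rw [avg_mul_of_indep (b i), ih]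
    · exact fun i₁ h₁ i₂ h₂ => hb i₁ (mem_insert_of_mem h₁) i₂ (mem_insert_of_mem h₂)
    · exact fun i₁ h₁ => hg i₁ (mem_insert_of_mem h₁)
    · intro A B
      exact hg i (mem_insert_self _ _) _ _ fun v hv => mem_mix_of_mem hv
    · intro A B
      refine prod_congr rfl fun i₁ h₁ => hg i₁ (mem_insert_of_mem h₁) _ _ fun v hv => ?_
      refine mem_mix_of_notMem fun hv' => ?_
      have := hb i (mem_insert_self _ _) i₁ (mem_insert_of_mem h₁) (by rintro rfl; exact hi h₁)
      exact Set.disjoint_left.1 this hv' hv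

lemma pr_mem_iff {W : Finset V} {v : V} (hv : v ∈ W) (b : Prop) :
    pr W (fun A => v ∈ A ↔ b) = 1 / 2 := by
  obtain ⟨W', hW', rfl⟩ : ∃ W', v ∉ W' ∧ W = insert v W' :=
    ⟨W.erase v, notMem_erase v W, (insert_erase hv).symm⟩
  have h0 : ∀ A ∈ W'.powerset, v ∉ A := fun A hA h => hW' (mem_powerset.1 hA h)
  unfold pr avg
  rw [sum_powerset_insert hW', card_insert_of_notMem hW', ← sum_add_distrib]
  rw [sum_congr rfl (g := fun _ => (1 : ℝ))]
  · simp only [sum_const, card_powerset, nsmul_eq_mul, mul_one, pow_succ]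
    push_cast
    field_simp
  · intro A hA
    by_cases hb : b <;> simp [hb, h0 A hA, ind]

/-- A uniformly random subset of `W` has prescribed trace on `Z ⊆ W` with probability
`2 ^ (-|Z|)`. -/
lemma pr_agree {W Z : Finset V} (hZ : Z ⊆ W) (τ : V → Prop) :
    pr W (fun A => ∀ v ∈ Z, (v ∈ A ↔ τ v)) = (1 / 2) ^ Z.card := by
  unfold pr
  simp only [ind_forall]
  rw [avg_prod Z (fun v => {v}) (fun v A => ind (v ∈ A ↔ τ v))]
  · exact (prod_congr rfl fun v hv => pr_mem_iff (hZ hv) (τ v)).trans (prod_const _)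
  · intro i _ j _ hij
    simpa using hij
  · intro i _ A B h
    simp [h i rfl]

lemma pr_mono {W : Finset V} {E E' : Finset V → Prop} (h : ∀ A ⊆ W, E A → E' A) :
    pr W E ≤ pr W E' :=
  avg_mono fun A hA => ind_le_ind (h A hA)

lemma pr_nonneg (W : Finset V) (E : Finset V → Prop) : 0 ≤ pr W E := by
  rw [← avg_const W 0]
  exact avg_mono fun A _ => ind_nonneg _

lemma pr_exists_le {ι : Type*} (W : Finset V) (I : Finset ι) (E : ι → Finset V → Prop) :
    pr W (fun A => ∃ i ∈ I, E i A) ≤ ∑ i ∈ I, pr W (E i) := by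
  unfold pr
  rw [← avg_sum]
  refine avg_mono fun A _ => ?_
  by_cases h : ∃ i ∈ I, E i A
  · rw [ind_true h]
    obtain ⟨i, hi, hE⟩ := h
    rw [← ind_true hE]
    exact single_le_sum (f := fun i => ind (E i A)) (fun j _ => ind_nonneg _) hi
  · rw [ind_false h]
    exact sum_nonneg fun j _ => ind_nonneg _

lemma pr_or_le (W : Finset V) (E E' : Finset V → Prop) :
    pr W (fun A => E A ∨ E' A) ≤ pr W E + pr W E' := by
  refine le_trans (pr_mono fun A _ h => ?_)
    ((pr_exists_le W univ fun b : Bool => if b then E else E').trans_eq (by simp))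
  exact h.elim (fun h => ⟨true, mem_univ _, h⟩) fun h => ⟨false, mem_univ _, h⟩

lemma pr_not (W : Finset V) (E : Finset V → Prop) : pr W (fun A => ¬ E A) = 1 - pr W E := by
  unfold pr
  rw [← avg_const W 1, ← avg_sub]
  congr 1
  ext A
  by_cases h : E A <;> simp [h, ind]

lemma pr_eq_zero {W : Finset V} {E : Finset V → Prop} (h : ∀ A, ¬ E A) : pr W E = 0 := by
  simp [pr, h, avg_const, ind]

lemma pr_le_of_mix_le {W : Finset V} {c : ℝ} (Q : Set V) {E : Finset V → Prop}
    (h : ∀ A, pr W (fun B => E (mix Q A B)) ≤ c) : pr W E ≤ c :=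
  avg_le_of_mix_le Q h

/-- If the events are determined by pairwise disjoint blocks of coordinates and each
has probability at least `c`, then all of them fail with probability at most `(1 - c) ^ |I|`. -/
lemma pr_forall_not_le {ι : Type*} {W : Finset V} (I : Finset ι) (b : ι → Set V)
    (E : ι → Finset V → Prop) {c : ℝ}
    (hb : ∀ i ∈ I, ∀ i' ∈ I, i ≠ i' → Disjoint (b i) (b i'))
    (hE : ∀ i ∈ I, ∀ A B : Finset V, (∀ v ∈ b i, (v ∈ A ↔ v ∈ B)) → (E i A ↔ E i B))
    (hc : ∀ i ∈ I, c ≤ pr W (E i)) :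
    pr W (fun A => ∀ i ∈ I, ¬ E i A) ≤ (1 - c) ^ I.card := by
  calc pr W (fun A => ∀ i ∈ I, ¬ E i A) = ∏ i ∈ I, pr W (fun A => ¬ E i A) := by
        unfold pr
        simp only [ind_forall]
        refine avg_prod I b (fun i A => ind (¬ E i A)) hb fun i hi A B h => ?_
        simp only [hE i hi A B h]
    _ ≤ ∏ _i ∈ I, (1 - c) := by
        refine prod_le_prod (fun i _ => pr_nonneg _ _) fun i hi => ?_
        rw [pr_not]
        linarith [hc i hi]
    _ = (1 - c) ^ I.card := prod_const _

/-! ### Random restrictions and decision trees -/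

/-- The pair `p` is selected by the set `ω` of true variables. -/
def Selected (k : ℕ) (ω : Finset RRefVar) (p : ℕ × ℕ) : Prop :=
  ∀ u ∈ Icc 1 k, RRefVar.S u p.1 p.2 ∈ ω

def IsSelector (k : ℕ) (v : RRefVar) : Prop :=
  ∃ u ∈ Icc 1 k, v = .S u v.homePair.1 v.homePair.2

/-- A state of the decision procedure assigns answers to some of the pairs. -/
abbrev PairState (Γ : Type) := ℕ × ℕ → Option Γ

/-- The value of a variable when the variables of unselected pairs and the selector variables
are given by `ω`, and the remaining ones are determined by the answers recorded in `α`. -/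
noncomputable def pval {Γ : Type} (k : ℕ) (val : Γ → RRefVar → Bool) (ω : Finset RRefVar)
    (α : PairState Γ) (v : RRefVar) : Option Bool :=
  if Selected k ω v.homePair then
    (α v.homePair).elim (if IsSelector k v then some true else none) (fun a => some (val a v))
  else some (decide (v ∈ ω))

/-- The term cannot be satisfied by any extension of `π`. -/
def DeadTerm {V : Type} (π : V → Option Bool) (q : PTerm V) : Prop :=
  falsPTerm π q ∨ ∃ v, (⟨v, true⟩ : Lit V) ∈ q ∧ (⟨v, false⟩ : Lit V) ∈ q

def Extends {Γ : Type} (β α : PairState Γ) : Prop := ∀ p a, α p = some a → β p = some a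

/-- The state `α` satisfies a term of `G`, or makes all of them dead. -/
def Decided {Γ : Type} (k : ℕ) (val : Γ → RRefVar → Bool) (ω : Finset RRefVar)
    (G : Dnf RRefVar) (α : PairState Γ) : Prop :=
  (∃ q ∈ G, satPTerm (pval k val ω α) q) ∨ ∀ q ∈ G, DeadTerm (pval k val ω α) q

/-- The DNF `G` is decided, starting from the state `α`, by a decision tree of height `h` that
queries selected pairs for answers in `Λ`. -/
def DecidedWithin {Γ : Type} (k : ℕ) (val : Γ → RRefVar → Bool) (Λ : Finset Γ)
    (ω : Finset RRefVar) (G : Dnf RRefVar) : ℕ → PairState Γ → Prop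
  | 0, α => Decided k val ω G α
  | h + 1, α => Decided k val ω G α ∨ ∃ p, Selected k ω p ∧ α p = none ∧
      ∀ a ∈ Λ, DecidedWithin k val Λ ω G h (Function.update α p (some a))

section Restriction

variable {Γ : Type} {k : ℕ} {val : Γ → RRefVar → Bool} {Λ : Finset Γ} {ω : Finset RRefVar}
  {α β : PairState Γ} {G : Dnf RRefVar}

lemma pval_of_not_selected {v : RRefVar} (h : ¬ Selected k ω v.homePair) :
    pval k val ω α v = some (decide (v ∈ ω)) := if_neg h

lemma pval_of_answer {v : RRefVar} {a : Γ} (h : Selected k ω v.homePair)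
    (ha : α v.homePair = some a) : pval k val ω α v = some (val a v) := by
  simp [pval, h, ha]

lemma pval_selector {v : RRefVar} (hval : ∀ a v, IsSelector k v → val a v = true)
    (h : Selected k ω v.homePair) (hv : IsSelector k v) : pval k val ω α v = some true := by
  cases ha : α v.homePair <;> simp [pval, h, hv, ha, hval]

lemma pval_mono (hval : ∀ a v, IsSelector k v → val a v = true) (h : Extends β α)
    {v : RRefVar} {b : Bool} (hb : pval k val ω α v = some b) : pval k val ω β v = some b := by
  by_cases hs : Selected k ω v.homePair
  · cases ha : α v.homePair with
    | some a => rwa [pval_of_answer hs (h _ _ ha), ← pval_of_answer hs ha]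
    | none =>
      by_cases hv : IsSelector k v
      · rw [pval_selector hval hs hv] at hb ⊢
        exact hb
      · simp [pval, hs, ha, hv] at hb
  · rwa [pval_of_not_selected hs] at hb ⊢

lemma extends_refl (α : PairState Γ) : Extends α α := fun _ _ h => h

lemma Extends.trans {γ : PairState Γ} (h : Extends γ β) (h' : Extends β α) : Extends γ α :=
  fun p a ha => h p a (h' p a ha)

lemma extends_update {p : ℕ × ℕ} (hp : α p = none) (a : Γ) :
    Extends (Function.update α p (some a)) α := by
  intro p' a' ha
  have : p' ≠ p := by rintro rfl; simp [hp] at ha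
  rwa [Function.update_of_ne this]

lemma satPTerm_mono (hval : ∀ a v, IsSelector k v → val a v = true) (h : Extends β α)
    {q : PTerm RRefVar} (hq : satPTerm (pval k val ω α) q) : satPTerm (pval k val ω β) q :=
  fun l hl => pval_mono hval h (hq l hl)

lemma deadTerm_mono (hval : ∀ a v, IsSelector k v → val a v = true) (h : Extends β α)
    {q : PTerm RRefVar} (hq : DeadTerm (pval k val ω α) q) : DeadTerm (pval k val ω β) q :=
  hq.imp_left fun ⟨l, hl, hf⟩ => ⟨l, hl, pval_mono hval h hf⟩

lemma not_deadTerm_of_sat {V : Type} {π : V → Option Bool} {q : PTerm V} (hs : satPTerm π q) :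
    ¬ DeadTerm π q := by
  rintro (⟨l, hl, hf⟩ | ⟨v, h1, h2⟩)
  · have h1 : π l.var = some l.pos := hs l hl
    have h2 : π l.var = some (!l.pos) := hf
    rw [h1] at h2
    cases h : l.pos <;> simp [h] at h2
  · have h1 : π v = some true := hs _ h1
    have h2 : π v = some false := hs _ h2
    simp [h1] at h2

lemma Decided.decidedWithin (h : Decided k val ω G α) (n : ℕ) :
    DecidedWithin k val Λ ω G n α := by
  cases n with
  | zero => exact h
  | succ n => exact Or.inl h

lemma DecidedWithin.succ {n : ℕ} (h : DecidedWithin k val Λ ω G n α) :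
    DecidedWithin k val Λ ω G (n + 1) α := by
  induction n generalizing α with
  | zero => exact Or.inl h
  | succ n ih =>
    obtain h | ⟨p, hp, hα, ha⟩ := h
    · exact Or.inl h
    · exact Or.inr ⟨p, hp, hα, fun a haΛ => ih (ha a haΛ)⟩

lemma DecidedWithin.mono {n n' : ℕ} (h : DecidedWithin k val Λ ω G n α) (hn : n ≤ n') :
    DecidedWithin k val Λ ω G n' α := by
  induction hn with
  | refl => exact h
  | step _ ih => exact ih.succ

/-- The set of variables whose home pair lies in `C`. -/
def homeIn (C : Finset (ℕ × ℕ)) : Set RRefVar := {v | v.homePair ∈ C}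

lemma selected_mix {C : Finset (ℕ × ℕ)} {ω₀ : Finset RRefVar} {p : ℕ × ℕ} (hp : p ∈ C) :
    Selected k (mix (homeIn C) ω₀ ω) p ↔ Selected k ω₀ p := by
  have : ∀ u, (RRefVar.S u p.1 p.2) ∈ homeIn C := fun u => hp
  simp only [Selected, mem_mix_of_mem (this _)]

lemma selected_mix_of_notMem {C : Finset (ℕ × ℕ)} {ω₀ : Finset RRefVar} {p : ℕ × ℕ}
    (hp : p ∉ C) : Selected k (mix (homeIn C) ω₀ ω) p ↔ Selected k ω p := by
  have : ∀ u, (RRefVar.S u p.1 p.2) ∉ homeIn C := fun u => hp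
  simp only [Selected, mem_mix_of_notMem (this _)]

lemma pval_mix {C : Finset (ℕ × ℕ)} {ω₀ : Finset RRefVar} {v : RRefVar} (hv : v.homePair ∈ C) :
    pval k val (mix (homeIn C) ω₀ ω) α v = pval k val ω₀ α v := by
  have : v ∈ homeIn C := hv
  simp only [pval, selected_mix hv, mem_mix_of_mem this]

lemma mix_homeIn_insert (C : Finset (ℕ × ℕ)) (p : ℕ × ℕ) (ω₀ ω₁ : Finset RRefVar) :
    mix (homeIn C) ω₀ (mix (homeIn {p}) ω₁ ω)
      = mix (homeIn (insert p C)) (mix (homeIn C) ω₀ ω₁) ω := by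
  ext v
  have hmem (C : Finset (ℕ × ℕ)) : v ∈ homeIn C ↔ v.homePair ∈ C := Iff.rfl
  by_cases h : v ∈ homeIn C
  · have h' : v ∈ homeIn (insert p C) := mem_insert_of_mem h
    rw [mem_mix_of_mem h, mem_mix_of_mem h', mem_mix_of_mem h]
  · rw [mem_mix_of_notMem h]
    by_cases hp : v.homePair = p
    · rw [mem_mix_of_mem ((hmem _).2 (mem_singleton.2 hp)),
        mem_mix_of_mem ((hmem _).2 (hp ▸ mem_insert_self _ _)), mem_mix_of_notMem h]
    · rw [mem_mix_of_notMem (by rwa [hmem, mem_singleton]),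
        mem_mix_of_notMem (by rw [hmem] at h ⊢; simp [h, hp])]

/-- The literals of `q` outside the home pairs in `C`. -/
def freePart (C : Finset (ℕ × ℕ)) (q : PTerm RRefVar) : PTerm RRefVar :=
  q.filter fun l => l.var.homePair ∉ C

/-- The term is contradictory or falsified already on the variables with home pair in `C`. -/
def DeadOn (k : ℕ) (val : Γ → RRefVar → Bool) (C : Finset (ℕ × ℕ)) (ω : Finset RRefVar)
    (α : PairState Γ) (q : PTerm RRefVar) : Prop :=
  (∃ l ∈ q, l.var.homePair ∈ C ∧ litFalsP (pval k val ω α) l) ∨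
    ∃ v, (⟨v, true⟩ : Lit RRefVar) ∈ q ∧ (⟨v, false⟩ : Lit RRefVar) ∈ q

lemma DeadOn.deadTerm {C : Finset (ℕ × ℕ)} {ω₀ : Finset RRefVar} {q : PTerm RRefVar}
    (h : DeadOn k val C ω₀ α q) : DeadTerm (pval k val (mix (homeIn C) ω₀ ω) α) q :=
  h.imp_left fun ⟨l, hl, hC, hf⟩ => ⟨l, hl, (pval_mix hC).trans hf⟩

lemma pval_ne_none {C : Finset (ℕ × ℕ)} {v : RRefVar} (hv : v.homePair ∈ C)
    (hdom : ∀ p ∈ C, Selected k ω p → α p ≠ none) : ∃ b, pval k val ω α v = some b := by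
  by_cases hs : Selected k ω v.homePair
  · obtain ⟨a, ha⟩ := Option.ne_none_iff_exists'.1 (hdom _ hv hs)
    exact ⟨_, pval_of_answer hs ha⟩
  · exact ⟨_, pval_of_not_selected hs⟩

lemma litSat_of_not_deadOn {C : Finset (ℕ × ℕ)} {q : PTerm RRefVar}
    (hdom : ∀ p ∈ C, Selected k ω p → α p ≠ none) (h : ¬ DeadOn k val C ω α q)
    {l : Lit RRefVar} (hl : l ∈ q) (hC : l.var.homePair ∈ C) :
    pval k val ω α l.var = some l.pos := by
  obtain ⟨b, hb⟩ := pval_ne_none (val := val) hC hdom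
  by_cases hbl : b = l.pos
  · rw [hb, hbl]
  · refine absurd (Or.inl ⟨l, hl, hC, ?_⟩) h
    rw [litFalsP, hb]
    congr 1
    revert hbl
    cases b <;> cases l.pos <;> simp

lemma exists_disjoint_or_cover {T : Finset (PTerm RRefVar)} {f : PTerm RRefVar → Finset (ℕ × ℕ)}
    {c : ℕ} (hne : ∀ q ∈ T, (f q).Nonempty) (hc : ∀ q ∈ T, (f q).card ≤ c) (m : ℕ) :
    (∃ S ⊆ T, S.card = m ∧ ∀ q ∈ S, ∀ q' ∈ S, q ≠ q' → Disjoint (f q) (f q')) ∨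
      ∃ X : Finset (ℕ × ℕ), X.card ≤ c * m ∧ ∀ q ∈ T, ∃ p ∈ f q, p ∈ X := by
  induction m with
  | zero => exact Or.inl ⟨∅, by simp⟩
  | succ m ih =>
    obtain ⟨S, hS, hm, hd⟩ | ⟨X, hX, h⟩ := ih
    · by_cases hX : ∀ q ∈ T, ∃ p ∈ f q, p ∈ S.biUnion f
      · refine Or.inr ⟨S.biUnion f, ?_, hX⟩
        refine (card_biUnion_le_card_mul S f c fun q hq => hc q (hS hq)).trans ?_
        rw [hm]
        nlinarith
      · push Not at hX
        obtain ⟨q, hq, hqX⟩ := hX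
        have hdisj : ∀ q' ∈ S, Disjoint (f q) (f q') := fun q' hq' =>
          disjoint_left.2 fun p hp hp' => hqX p hp (mem_biUnion.2 ⟨q', hq', hp'⟩)
        have hqS : q ∉ S := fun h => by
          obtain ⟨p, hp⟩ := hne q hq
          exact hqX p hp (mem_biUnion.2 ⟨q, h, hp⟩)
        refine Or.inl ⟨insert q S, insert_subset hq hS, by rw [card_insert_of_notMem hqS, hm], ?_⟩
        intro q₁ h₁ q₂ h₂ hne
        rw [mem_insert] at h₁ h₂
        obtain rfl | h₁ := h₁ <;> obtain rfl | h₂ := h₂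
        · exact absurd rfl hne
        · exact hdisj _ h₂
        · exact (hdisj _ h₁).symm
        · exact hd _ h₁ _ h₂ hne
    · exact Or.inr ⟨X, hX.trans (by gcongr; omega), h⟩

/-- A selector variable of `p` that the term `q` does not require to be true, if there is one. -/
noncomputable def escapeVar (k : ℕ) (q : PTerm RRefVar) (p : ℕ × ℕ) : RRefVar :=
  if h : ∃ u ∈ Icc 1 k, (⟨.S u p.1 p.2, true⟩ : Lit RRefVar) ∉ q then .S h.choose p.1 p.2
  else .S 1 p.1 p.2

lemma escapeVar_spec (k : ℕ) (hk : 1 ≤ k) (q : PTerm RRefVar) (p : ℕ × ℕ) :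
    ∃ u ∈ Icc 1 k, escapeVar k q p = .S u p.1 p.2 := by
  unfold escapeVar
  split_ifs with h
  · exact ⟨_, h.choose_spec.1, rfl⟩
  · exact ⟨1, by simp [hk], rfl⟩

lemma homePair_escapeVar (k : ℕ) (q : PTerm RRefVar) (p : ℕ × ℕ) :
    (escapeVar k q p).homePair = p := by
  unfold escapeVar
  split_ifs <;> rfl

lemma escapeVar_notMem {q : PTerm RRefVar} {p : ℕ × ℕ}
    (h : ∃ u ∈ Icc 1 k, (⟨.S u p.1 p.2, true⟩ : Lit RRefVar) ∉ q) :
    (⟨escapeVar k q p, true⟩ : Lit RRefVar) ∉ q := by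
  rw [escapeVar, dif_pos h]
  exact h.choose_spec.2

/-- The pairs touched by the free part of a term. -/
def freePairs (C : Finset (ℕ × ℕ)) (q : PTerm RRefVar) : Finset (ℕ × ℕ) :=
  (freePart C q).image fun l => l.var.homePair

/-- The variables whose values can force the term `q` to be satisfied. -/
noncomputable def forcingVars (k : ℕ) (C : Finset (ℕ × ℕ)) (q : PTerm RRefVar) : Finset RRefVar :=
  (freePart C q).image Lit.var ∪ (freePairs C q).image (escapeVar k q)

lemma card_forcingVars_le (k : ℕ) (C : Finset (ℕ × ℕ)) (q : PTerm RRefVar) :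
    (forcingVars k C q).card ≤ 2 * (freePart C q).card := by
  refine (card_union_le _ _).trans ?_
  rw [two_mul]
  exact add_le_add card_image_le (card_image_le.trans card_image_le)

lemma homePair_mem_freePairs {C : Finset (ℕ × ℕ)} {q : PTerm RRefVar} {v : RRefVar}
    (hv : v ∈ forcingVars k C q) : v.homePair ∈ freePairs C q := by
  rcases mem_union.1 hv with hv | hv
  · obtain ⟨l, hl, rfl⟩ := mem_image.1 hv
    exact mem_image_of_mem _ hl
  · obtain ⟨p, hp, rfl⟩ := mem_image.1 hv
    rwa [homePair_escapeVar]

lemma satPTerm_of_forcing (hk : 1 ≤ k) {C : Finset (ℕ × ℕ)} {ω₀ : Finset RRefVar}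
    {q : PTerm RRefVar} (hdomC : ∀ p, α p ≠ none → p ∈ C)
    (hdom : ∀ p ∈ C, Selected k ω₀ p → α p ≠ none) (hq : ¬ DeadOn k val C ω₀ α q)
    (hcard : q.card ≤ k)
    (hω : ∀ v ∈ forcingVars k C q, (v ∈ ω ↔ (⟨v, true⟩ : Lit RRefVar) ∈ q)) :
    satPTerm (pval k val (mix (homeIn C) ω₀ ω) α) q := by
  intro l hl
  rw [litSatP]
  by_cases hC : l.var.homePair ∈ C
  · rw [pval_mix hC]
    exact litSat_of_not_deadOn hdom hq hl hC
  have hfree : l ∈ freePart C q := mem_filter.2 ⟨hl, hC⟩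
  have hmem : l.var ∈ mix (homeIn C) ω₀ ω ↔ l.var ∈ ω := mem_mix_of_notMem hC
  have hval : decide (l.var ∈ mix (homeIn C) ω₀ ω) = l.pos := by
    have h1 := hω l.var (mem_union_left _ (mem_image_of_mem _ hfree))
    rw [Bool.eq_iff_iff, decide_eq_true_iff, hmem, h1]
    constructor
    · intro h
      by_contra hpos
      refine hq (Or.inr ⟨l.var, h, ?_⟩)
      have : l = ⟨l.var, false⟩ := by
        cases l
        simp_all
      rwa [← this]
    · intro h
      rwa [← h]
  by_cases hs : Selected k (mix (homeIn C) ω₀ ω) l.var.homePair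
  · have hp : l.var.homePair ∈ freePairs C q := mem_image_of_mem _ hfree
    have hall : ∀ u ∈ Icc 1 k,
        (⟨.S u l.var.homePair.1 l.var.homePair.2, true⟩ : Lit RRefVar) ∈ q := by
      by_contra hex
      push Not at hex
      have h1 := hω _ (mem_union_right _ (mem_image_of_mem (escapeVar k q) hp))
      obtain ⟨u, hu, he⟩ := escapeVar_spec k hk q l.var.homePair
      have h2 := (selected_mix_of_notMem hC).1 hs u hu
      rw [← he] at h2
      exact escapeVar_notMem hex (h1.1 h2)
    have hsub : (Icc 1 k).image (fun u =>
        (⟨.S u l.var.homePair.1 l.var.homePair.2, true⟩ : Lit RRefVar)) = q := by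
      refine eq_of_subset_of_card_le ?_ ?_
      · intro x hx
        obtain ⟨u, hu, rfl⟩ := mem_image.1 hx
        exact hall u hu
      · rw [card_image_of_injective]
        · simpa using hcard
        · intro u u' h
          simpa using h
    have hl' := hl
    rw [← hsub] at hl'
    obtain ⟨u, hu, hlu⟩ := mem_image.1 hl'
    have hsel : IsSelector k l.var := by
      refine ⟨u, hu, ?_⟩
      conv_lhs => rw [← hlu]
    have hnone : α l.var.homePair = none := by
      by_contra h
      exact hC (hdomC _ h)
    have hpos : l.pos = true := by rw [← hlu]
    simp [pval, hs, hsel, hnone, hpos]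
  · rw [pval_of_not_selected hs, hval]

/-- The height of the decision trees produced for `j`-DNFs with thresholds `m`. -/
def treeHeight (m : ℕ → ℕ) : ℕ → ℕ
  | 0 => 0
  | j + 1 => treeHeight m j + (j + 1) * m (j + 1)

/-- The terms of `G` are dead or have at most `j` literals outside the pairs of `C`. -/
def FreeWidthLE (k : ℕ) (val : Γ → RRefVar → Bool) (C X : Finset (ℕ × ℕ)) (ω : Finset RRefVar)
    (α : PairState Γ) (G : Dnf RRefVar) (j : ℕ) : Prop :=
  ∀ q ∈ G, DeadOn k val C ω α q ∨ (freePart (C ∪ X) q).card ≤ j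

lemma FreeWidthLE.insert {C X : Finset (ℕ × ℕ)} {p : ℕ × ℕ} {ω₀ ω₁ : Finset RRefVar} {j : ℕ}
    (hval : ∀ a v, IsSelector k v → val a v = true)
    (h : FreeWidthLE k val C (insert p X) ω₀ α G j) (hβ : Extends β α) :
    FreeWidthLE k val (insert p C) X (mix (homeIn C) ω₀ ω₁) β G j := by
  intro q hq
  refine (h q hq).imp ?_ ?_
  · refine fun h => h.imp_left fun ⟨l, hl, hC, hf⟩ => ⟨l, hl, mem_insert_of_mem hC, ?_⟩
    exact pval_mono hval hβ ((pval_mix hC).trans hf)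
  · rw [union_insert, insert_union]
    exact id

/-- One more query costs a union bound over the possible answers. -/
lemma pr_not_decided_insert_le {W : Finset RRefVar} {C : Finset (ℕ × ℕ)} {p : ℕ × ℕ}
    {ω₀ : Finset RRefVar} {h : ℕ} {ε : ℝ} (hΛ : 1 ≤ Λ.card) (hε : 0 ≤ ε) (hα : α p = none)
    (hp : p ∉ C)
    (hsel : ∀ ω₁, Selected k ω₁ p → ∀ a ∈ Λ,
      pr W (fun ω => ¬ DecidedWithin k val Λ (mix (homeIn (insert p C)) (mix (homeIn C) ω₀ ω₁) ω)
        G h (Function.update α p (some a))) ≤ ε)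
    (hunsel : ∀ ω₁, ¬ Selected k ω₁ p →
      pr W (fun ω => ¬ DecidedWithin k val Λ (mix (homeIn (insert p C)) (mix (homeIn C) ω₀ ω₁) ω)
        G h α) ≤ ε) :
    pr W (fun ω => ¬ DecidedWithin k val Λ (mix (homeIn C) ω₀ ω) G (h + 1) α)
      ≤ Λ.card * ε := by
  refine pr_le_of_mix_le (homeIn {p}) fun ω₁ => ?_
  simp only [mix_homeIn_insert]
  by_cases hs : Selected k ω₁ p
  · have hs' : ∀ ω, Selected k (mix (homeIn (insert p C)) (mix (homeIn C) ω₀ ω₁) ω) p := fun ω =>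
      (selected_mix (mem_insert_self _ _)).2 ((selected_mix_of_notMem hp).2 hs)
    calc _ ≤ pr W (fun ω => ∃ a ∈ Λ, ¬ DecidedWithin k val Λ
            (mix (homeIn (insert p C)) (mix (homeIn C) ω₀ ω₁) ω) G h
            (Function.update α p (some a))) := by
          refine pr_mono fun ω _ hn => ?_
          by_contra hcon
          push Not at hcon
          exact hn (Or.inr ⟨p, hs' ω, hα, hcon⟩)
      _ ≤ ∑ _a ∈ Λ, ε := (pr_exists_le _ _ _).trans (sum_le_sum fun a ha => hsel ω₁ hs a ha)
      _ = Λ.card * ε := by simp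
  · calc _ ≤ pr W (fun ω => ¬ DecidedWithin k val Λ
            (mix (homeIn (insert p C)) (mix (homeIn C) ω₀ ω₁) ω) G h α) :=
          pr_mono fun ω _ => mt DecidedWithin.succ
      _ ≤ ε := hunsel ω₁ hs
      _ ≤ Λ.card * ε := le_mul_of_one_le_left hε (by exact_mod_cast hΛ)

lemma pr_not_decided_cover_le {W : Finset RRefVar} {h j : ℕ} {ε : ℝ}
    (hval : ∀ a v, IsSelector k v → val a v = true) (hΛ : 1 ≤ Λ.card) (hε : 0 ≤ ε)
    (base : ∀ (C : Finset (ℕ × ℕ)) (α : PairState Γ) (ω₀ : Finset RRefVar),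
      (∀ p, α p ≠ none → p ∈ C) → (∀ p ∈ C, Selected k ω₀ p → α p ≠ none) →
      FreeWidthLE k val C ∅ ω₀ α G j →
      pr W (fun ω => ¬ DecidedWithin k val Λ (mix (homeIn C) ω₀ ω) G h α) ≤ ε)
    (X : Finset (ℕ × ℕ)) :
    ∀ (C : Finset (ℕ × ℕ)) (α : PairState Γ) (ω₀ : Finset RRefVar),
      (∀ p, α p ≠ none → p ∈ C) → (∀ p ∈ C, Selected k ω₀ p → α p ≠ none) →
      FreeWidthLE k val C X ω₀ α G j →
      pr W (fun ω => ¬ DecidedWithin k val Λ (mix (homeIn C) ω₀ ω) G (h + X.card) α)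
        ≤ (Λ.card : ℝ) ^ X.card * ε := by
  have hM : (1 : ℝ) ≤ Λ.card := by exact_mod_cast hΛ
  induction X using Finset.induction_on with
  | empty =>
    intro C α ω₀ h1 h2 h3
    simpa using base C α ω₀ h1 h2 h3
  | insert p X hpX ih =>
    intro C α ω₀ h1 h2 h3
    rw [card_insert_of_notMem hpX, ← add_assoc, pow_succ', mul_assoc]
    by_cases hp : p ∈ C
    · have h3' : FreeWidthLE k val C X ω₀ α G j := by
        unfold FreeWidthLE at h3 ⊢
        rwa [union_insert, insert_eq_self.2 (mem_union_left _ hp)] at h3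
      calc _ ≤ _ := pr_mono fun ω _ => mt DecidedWithin.succ
        _ ≤ _ := ih C α ω₀ h1 h2 h3'
        _ ≤ _ := le_mul_of_one_le_left (by positivity) hM
    · have hα : α p = none := by
        by_contra hne
        exact hp (h1 p hne)
      have hdom : ∀ ω₁ p', p' ∈ C → Selected k (mix (homeIn C) ω₀ ω₁) p' → α p' ≠ none :=
        fun ω₁ p' hp' hs => h2 p' hp' ((selected_mix hp').1 hs)
      refine pr_not_decided_insert_le hΛ (by positivity) hα hp ?_ ?_
      · intro ω₁ hs a _
        refine ih _ _ _ ?_ ?_ (h3.insert hval (extends_update hα a))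
        · intro p' hp'
          by_cases hpp : p' = p
          · exact hpp ▸ mem_insert_self _ _
          · rw [Function.update_of_ne hpp] at hp'
            exact mem_insert_of_mem (h1 p' hp')
        · intro p' hp' hs'
          by_cases hpp : p' = p
          · subst hpp
            simp
          · rw [Function.update_of_ne hpp]
            exact hdom ω₁ p' ((mem_insert.1 hp').resolve_left hpp) hs'
      · intro ω₁ hs
        refine ih _ _ _ (fun p' hp' => mem_insert_of_mem (h1 p' hp')) ?_
          (h3.insert hval (extends_refl α))
        intro p' hp' hsel
        obtain rfl | hp' := mem_insert.1 hp'
        · exact absurd ((selected_mix_of_notMem hp).1 hsel) hs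
        · exact hdom ω₁ p' hp' hsel

/-- The switching lemma: a `k`-DNF is decided by a shallow decision tree with high probability. -/
theorem pr_not_decidedWithin_le (hk : 1 ≤ k) (hval : ∀ a v, IsSelector k v → val a v = true)
    (hΛ : 1 ≤ Λ.card) {W : Finset RRefVar} (hG : IsKDnf k G)
    (hW : ∀ q ∈ G, ∀ l ∈ q, l.var ∈ W ∧
      ∀ u ∈ Icc 1 k, RRefVar.S u l.var.homePair.1 l.var.homePair.2 ∈ W)
    (m : ℕ → ℕ) (ε : ℕ → ℝ) (hε : ∀ j, 0 ≤ ε j)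
    (hdisj : ∀ j < k, (1 - (1 / 4 : ℝ) ^ (j + 1)) ^ m (j + 1) ≤ ε (j + 1))
    (hcover : ∀ j < k, (Λ.card : ℝ) ^ ((j + 1) * m (j + 1)) * ε j ≤ ε (j + 1)) :
    ∀ j ≤ k, ∀ (C : Finset (ℕ × ℕ)) (α : PairState Γ) (ω₀ : Finset RRefVar),
      (∀ p, α p ≠ none → p ∈ C) → (∀ p ∈ C, Selected k ω₀ p → α p ≠ none) →
      FreeWidthLE k val C ∅ ω₀ α G j →
      pr W (fun ω => ¬ DecidedWithin k val Λ (mix (homeIn C) ω₀ ω) G (treeHeight m j) α) ≤ ε j := by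
  have hM : (1 : ℝ) ≤ Λ.card := by exact_mod_cast hΛ
  have settled : ∀ (C : Finset (ℕ × ℕ)) (α : PairState Γ) (ω₀ : Finset RRefVar) (h : ℕ) (q),
      (∀ p ∈ C, Selected k ω₀ p → α p ≠ none) → q ∈ G → ¬ DeadOn k val C ω₀ α q →
      freePart C q = ∅ →
      pr W (fun ω => ¬ DecidedWithin k val Λ (mix (homeIn C) ω₀ ω) G h α) = 0 := by
    intro C α ω₀ h q hdom hq hdead hfree
    refine pr_eq_zero fun ω => not_not.2 (Decided.decidedWithin (Or.inl ⟨q, hq, ?_⟩) _)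
    intro l hl
    have hC : l.var.homePair ∈ C := by
      by_contra hC
      have : l ∈ freePart C q := mem_filter.2 ⟨hl, hC⟩
      simp [hfree] at this
    exact (pval_mix hC).trans (litSat_of_not_deadOn hdom hdead hl hC)
  intro j
  induction j with
  | zero =>
    intro _ C α ω₀ h1 h2 h3
    by_cases hex : ∃ q ∈ G, ¬ DeadOn k val C ω₀ α q
    · obtain ⟨q, hq, hdead⟩ := hex
      have := (h3 q hq).resolve_left hdead
      rw [union_empty, Nat.le_zero, card_eq_zero] at this
      exact (settled C α ω₀ _ q h2 hq hdead this).trans_le (hε 0)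
    · push Not at hex
      refine (pr_eq_zero fun ω => not_not.2 ?_).trans_le (hε 0)
      exact Or.inr fun q hq => (hex q hq).deadTerm
  | succ j ih =>
    intro hj C α ω₀ h1 h2 h3
    set T := G.filter fun q => ¬ DeadOn k val C ω₀ α q with hT
    have hTG : ∀ q ∈ T, q ∈ G ∧ ¬ DeadOn k val C ω₀ α q := fun q hq => mem_filter.1 hq
    have hTcard : ∀ q ∈ T, (freePart C q).card ≤ j + 1 := fun q hq => by
      have := (h3 q (hTG q hq).1).resolve_left (hTG q hq).2
      rwa [union_empty] at this
    by_cases hex : ∃ q ∈ T, freePart C q = ∅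
    · obtain ⟨q, hq, hfree⟩ := hex
      exact (settled C α ω₀ _ q h2 (hTG q hq).1 (hTG q hq).2 hfree).trans_le (hε _)
    have hne : ∀ q ∈ T, (freePairs C q).Nonempty := fun q hq =>
      (nonempty_iff_ne_empty.2 fun h => hex ⟨q, hq, h⟩).image _
    obtain ⟨S, hST, hSm, hSd⟩ | ⟨X, hXm, hX⟩ := exists_disjoint_or_cover hne
      (fun q hq => card_image_le.trans (hTcard q hq)) (m (j + 1))
    · refine le_trans ?_ (hdisj j hj)
      rw [← hSm]
      refine (pr_mono fun ω _ hn => ?_).trans (pr_forall_not_le S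
        (fun q => {v | v.homePair ∈ freePairs C q})
        (fun q ω => ∀ v ∈ forcingVars k C q, (v ∈ ω ↔ (⟨v, true⟩ : Lit RRefVar) ∈ q)) ?_ ?_ ?_)
      · intro q hq hω
        obtain ⟨hqG, hqd⟩ := hTG q (hST hq)
        exact hn (Decided.decidedWithin
          (Or.inl ⟨q, hqG, satPTerm_of_forcing hk h1 h2 hqd (hG q hqG) hω⟩) _)
      · intro q hq q' hq' hqq
        exact Set.disjoint_left.2 fun v hv hv' => disjoint_left.1 (hSd q hq q' hq' hqq) hv hv'
      · intro q _ A B hAB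
        refine forall₂_congr fun v hv => ?_
        rw [hAB v (homePair_mem_freePairs hv)]
      · intro q hq
        have hqW : forcingVars k C q ⊆ W := by
          intro v hv
          rcases mem_union.1 hv with hv | hv
          · obtain ⟨l, hl, rfl⟩ := mem_image.1 hv
            exact (hW q (hTG q (hST hq)).1 l (mem_filter.1 hl).1).1
          · obtain ⟨p, hp, rfl⟩ := mem_image.1 hv
            obtain ⟨l, hl, rfl⟩ := mem_image.1 hp
            obtain ⟨u, hu, he⟩ := escapeVar_spec k hk q l.var.homePair
            rw [he]
            exact (hW q (hTG q (hST hq)).1 l (mem_filter.1 hl).1).2 u hu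
        rw [pr_agree hqW]
        calc (1 / 4 : ℝ) ^ (j + 1) = (1 / 2) ^ (2 * (j + 1)) := by
              rw [pow_mul]
              norm_num
          _ ≤ (1 / 2) ^ (forcingVars k C q).card := by
              refine pow_le_pow_of_le_one (by norm_num) (by norm_num) ?_
              exact (card_forcingVars_le k C q).trans
                (Nat.mul_le_mul_left _ (hTcard q (hST hq)))
    · have h3' : FreeWidthLE k val C X ω₀ α G j := by
        intro q hq
        by_cases hdead : DeadOn k val C ω₀ α q
        · exact Or.inl hdead
        · right
          have hqT : q ∈ T := mem_filter.2 ⟨hq, hdead⟩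
          obtain ⟨p, hp, hpX⟩ := hX q hqT
          obtain ⟨l, hl, rfl⟩ := mem_image.1 hp
          have hss : freePart (C ∪ X) q ⊂ freePart C q := by
            refine Finset.ssubset_iff_subset_ne.2 ⟨fun l' hl' => ?_, fun he => ?_⟩
            · rw [freePart, mem_filter] at hl' ⊢
              exact ⟨hl'.1, fun h => hl'.2 (mem_union_left _ h)⟩
            · rw [← he] at hl
              exact (mem_filter.1 hl).2 (mem_union_right _ hpX)
          have := card_lt_card hss
          have := hTcard q hqT
          omega
      calc _ ≤ _ := pr_mono fun ω _ => mt fun h => DecidedWithin.mono h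
            (Nat.add_le_add_left hXm (treeHeight m j))
        _ ≤ _ := pr_not_decided_cover_le hval hΛ (hε j) (ih (by omega)) X C α ω₀ h1 h2 h3'
        _ ≤ (Λ.card : ℝ) ^ ((j + 1) * m (j + 1)) * ε j :=
            mul_le_mul_of_nonneg_right (pow_le_pow_right₀ hM hXm) (hε j)
        _ ≤ _ := hcover j hj

end Restriction

/-! ### Refuting a refutation with a consistent strategy -/

/-- At most `c` pairs have been answered in the state `α`. -/
def DomLE {Γ : Type} (α : PairState Γ) (c : ℕ) : Prop :=
  ∃ D : Finset (ℕ × ℕ), D.card ≤ c ∧ ∀ p, α p ≠ none → p ∈ D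

section Strategy

variable {Γ : Type} {k : ℕ} {val : Γ → RRefVar → Bool} {Λ : Finset Γ} {ω : Finset RRefVar}
  {Adm : PairState Γ → Prop}

lemma domLE_none (c : ℕ) : DomLE (fun _ => none : PairState Γ) c :=
  ⟨∅, by simp, fun _ h => absurd rfl h⟩

lemma DomLE.update {α : PairState Γ} {c : ℕ} (h : DomLE α c) (p : ℕ × ℕ) (a : Γ) :
    DomLE (Function.update α p (some a)) (c + 1) := by
  obtain ⟨D, hD, hp⟩ := h
  refine ⟨insert p D, (card_insert_le _ _).trans (by lia), fun p' hp' => ?_⟩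
  by_cases hpp : p' = p
  · exact hpp ▸ mem_insert_self _ _
  · rw [Function.update_of_ne hpp] at hp'
    exact mem_insert_of_mem (hp p' hp')

/-- A strategy that keeps answering can follow a decision tree for `G` until `G` is decided. -/
lemma DecidedWithin.exists_answers {G : Dnf RRefVar} {c : ℕ}
    (hmem : ∀ α, Adm α → ∀ p a, α p = some a → a ∈ Λ)
    (hext : ∀ α c', Adm α → DomLE α c' → c' < c → ∀ p, Selected k ω p → α p = none →
      ∃ a ∈ Λ, Adm (Function.update α p (some a))) (m : ℕ) :
    ∀ (π σ : PairState Γ) (b d : ℕ), DecidedWithin k val Λ ω G m π → Extends σ π → Adm σ →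
      DomLE π b → DomLE σ d → d + m ≤ c →
      ∃ π' σ', Adm σ' ∧ Extends σ' σ ∧ Extends σ' π' ∧ DomLE π' (b + m) ∧ DomLE σ' (d + m) ∧
        Decided k val ω G π' := by
  have hle {α : PairState Γ} {b b' : ℕ} (h : DomLE α b) (hb : b ≤ b') : DomLE α b' :=
    let ⟨D, hD, hp⟩ := h
    ⟨D, hD.trans hb, hp⟩
  induction m with
  | zero =>
    intro π σ b d hG he hσ hπd hσd _
    exact ⟨π, σ, hσ, extends_refl _, he, hπd, hσd, hG⟩
  | succ m ih =>
    intro π σ b d hG he hσ hπd hσd hdc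
    obtain hG | ⟨p, hp, hπp, hG⟩ := hG
    · exact ⟨π, σ, hσ, extends_refl _, he, hle hπd (by lia), hle hσd (by lia), hG⟩
    · cases hσp : σ p with
      | some a =>
        have he' : Extends σ (Function.update π p (some a)) := by
          intro p' a' h
          by_cases hpp : p' = p
          · subst hpp
            simpa [hσp] using h
          · rw [Function.update_of_ne hpp] at h
            exact he p' a' h
        obtain ⟨π', σ', h1, h2, h3, h4, h5, h6⟩ :=
          ih _ σ (b + 1) d (hG a (hmem σ hσ p a hσp)) he' hσ (hπd.update p a) hσd (by lia)
        exact ⟨π', σ', h1, h2, h3, hle h4 (by lia), hle h5 (by lia), h6⟩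
      | none =>
        obtain ⟨a, ha, hadm⟩ := hext σ d hσ hσd (by lia) p hp hσp
        have he' : Extends (Function.update σ p (some a)) (Function.update π p (some a)) := by
          intro p' a' h
          by_cases hpp : p' = p
          · subst hpp
            simpa using h
          · rw [Function.update_of_ne hpp] at h ⊢
            exact he p' a' h
        obtain ⟨π', σ', h1, h2, h3, h4, h5, h6⟩ :=
          ih _ _ (b + 1) (d + 1) (hG a ha) he' hadm (hπd.update p a) (hσd.update p a) (by lia)
        exact ⟨π', σ', h1, h2.trans (extends_update hσp a), h3, hle h4 (by lia),
          hle h5 (by lia), h6⟩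

/-- If every line is decided by a shallow decision tree, a strategy that never falsifies an
initial clause excludes a refutation. -/
theorem not_refutation_of_strategy {F : Set (Clause RRefVar)} {P : List (Dnf RRefVar)} {h : ℕ}
    (hval : ∀ a v, IsSelector k v → val a v = true)
    (hnone : Adm fun _ => none) (hrestr : ∀ α β, Adm β → Extends β α → Adm α)
    (hmem : ∀ α, Adm α → ∀ p a, α p = some a → a ∈ Λ)
    (hext : ∀ α c', Adm α → DomLE α c' → c' < 3 * h → ∀ p, Selected k ω p → α p = none →
      ∃ a ∈ Λ, Adm (Function.update α p (some a)))
    (hfalse : ∀ α, Adm α → ∀ C ∈ F, ¬ ∀ l ∈ C, litFalsP (pval k val ω α) l)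
    (hdec : ∀ G ∈ P, DecidedWithin k val Λ ω G h fun _ => none) : ¬ IsResKRefutation k F P := by
  rintro ⟨hne, hlast, -, hinf⟩
  have key : ∀ N : ℕ, ∀ i : Fin P.length, (i : ℕ) = N → ∀ π, Adm π → DomLE π h →
      ¬ ∀ q ∈ P.get i, DeadTerm (pval k val ω π) q := by
    intro N
    induction N using Nat.strong_induction_on with
    | _ N ih =>
    intro i hi π hπ hπd hdead
    have hrun : ∀ Q, (∃ j : Fin P.length, (j : ℕ) < i ∧ P.get j = Q) → ∀ σ d, Adm σ → DomLE σ d →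
        d + h ≤ 3 * h → ∃ σ', Adm σ' ∧ Extends σ' σ ∧ DomLE σ' (d + h) ∧
          ∃ q ∈ Q, satPTerm (pval k val ω σ') q := by
      rintro Q ⟨j, hj, rfl⟩ σ d hσ hσd hd
      obtain ⟨π', σ', h1, h2, h3, h4, h5, h6⟩ := DecidedWithin.exists_answers hmem hext h
        (fun _ => none) σ 0 d (hdec _ (List.get_mem P j)) (fun _ _ h => by simp at h) hσ
        (domLE_none 0) hσd hd
      refine ⟨σ', h1, h2, h5, ?_⟩
      obtain ⟨q, hq, hs⟩ | h6 := h6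
      · exact ⟨q, hq, satPTerm_mono hval h3 hs⟩
      · rw [Nat.zero_add] at h4
        exact absurd h6 (ih _ (hi ▸ hj) j rfl π' (hrestr _ _ h1 h3) h4)
    have hcontra : ∀ σ, Extends σ π → ∀ q ∈ P.get i, ¬ satPTerm (pval k val ω σ) q :=
      fun σ he q hq hs => not_deadTerm_of_sat hs (deadTerm_mono hval he (hdead q hq))
    obtain ⟨C, hC, hPi⟩ | ⟨prems, hr, hprem⟩ := hinf i
    · refine hfalse π hπ C hC fun l hl => ?_
      have := hdead {l} (by rw [hPi]; exact mem_image_of_mem _ hl)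
      obtain ⟨l', hl', hf⟩ | ⟨v, hv, hv'⟩ := this
      · rwa [mem_singleton.1 hl'] at hf
      · rw [mem_singleton] at hv hv'
        simpa using hv.trans hv'.symm
    · generalize P.get i = G at *
      cases hr with
      | ax x =>
        have hlit : ∀ b, (⟨x, b⟩ : Lit RRefVar) ∈ ({⟨x, true⟩} : PTerm RRefVar) ∨
            (⟨x, b⟩ : Lit RRefVar) ∈ ({⟨x, false⟩} : PTerm RRefVar) := by
          intro b
          cases b <;> simp
        have hf : ∀ b, pval k val ω π x = some (!b) := by
          intro b
          have := hdead {⟨x, b⟩} (by cases b <;> simp)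
          obtain ⟨l', hl', hf⟩ | ⟨v, hv, hv'⟩ := this
          · rwa [mem_singleton.1 hl'] at hf
          · rw [mem_singleton] at hv hv'
            simpa using hv.trans hv'.symm
        simpa [hf true] using hf false
      | weaken A B =>
        obtain ⟨σ, -, he, -, q, hq, hs⟩ := hrun A (hprem A (by simp)) π h hπ hπd (by lia)
        exact hcontra σ he q (mem_union_left _ hq) hs
      | andIntro A B l q hq =>
        obtain ⟨σ, hσ, he, hσd, q₁, hq₁, hs₁⟩ :=
          hrun _ (hprem _ List.mem_cons_self) π h hπ hπd (by lia)
        obtain ⟨σ', -, he', -, q₂, hq₂, hs₂⟩ :=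
          hrun _ (hprem _ (List.mem_cons_of_mem _ List.mem_cons_self)) σ _ hσ hσd (by lia)
        have hs₁' := satPTerm_mono hval he' hs₁
        have hee := he'.trans he
        rcases mem_union.1 hq₁ with hq₁ | hq₁
        · exact hcontra σ' hee q₁ (by simp [hq₁]) hs₁'
        rcases mem_union.1 hq₂ with hq₂ | hq₂
        · exact hcontra σ' hee q₂ (by simp [hq₂]) hs₂
        rw [mem_singleton] at hq₁ hq₂
        subst hq₁ hq₂
        refine hcontra σ' hee _ (mem_union_right _ (mem_singleton_self _)) fun l' hl' => ?_
        rcases mem_insert.1 hl' with rfl | hl'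
        · exact hs₁' _ (mem_singleton_self _)
        · exact hs₂ l' hl'
      | cut A B q =>
        obtain ⟨σ, hσ, he, hσd, q₁, hq₁, hs₁⟩ :=
          hrun _ (hprem _ List.mem_cons_self) π h hπ hπd (by lia)
        obtain ⟨σ', -, he', -, q₂, hq₂, hs₂⟩ :=
          hrun _ (hprem _ (List.mem_cons_of_mem _ List.mem_cons_self)) σ _ hσ hσd (by lia)
        have hs₁' := satPTerm_mono hval he' hs₁
        have hee := he'.trans he
        rcases mem_union.1 hq₁ with hq₁ | hq₁
        · exact hcontra σ' hee q₁ (by simp [hq₁]) hs₁'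
        rcases mem_union.1 hq₂ with hq₂ | hq₂
        · exact hcontra σ' hee q₂ (by simp [hq₂]) hs₂
        rw [mem_singleton] at hq₁
        subst hq₁
        obtain ⟨l, hl, rfl⟩ := mem_image.1 hq₂
        have h1 : _ = some l.pos := hs₁' l hl
        have h2 : _ = some (!l.pos) := hs₂ l.neg (mem_singleton_self _)
        rw [show l.neg.var = l.var from rfl, h1] at h2
        cases hb : l.pos <;> simp [hb] at h2
  have hlen : P.length - 1 < P.length := Nat.sub_lt (List.length_pos_iff.2 hne) one_pos
  refine key _ ⟨P.length - 1, hlen⟩ rfl _ hnone (domLE_none h) fun q hq => ?_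
  rw [List.getLast?_eq_some_getLast hne, List.getLast_eq_getElem, Option.some_inj] at hlast
  rw [List.get_eq_getElem, hlast] at hq
  simp at hq

end Strategy

/-! ### The strategy for `R^kREF^F_{s,t}` -/

/-- An answer for a pair: a set of variables of `F`, whose falsified clause is put on the pair,
and the two children of the pair. -/
abbrev Answer := Finset ℕ × ℕ × ℕ

def answers (n t : ℕ) : Finset Answer := (Icc 1 n).powerset ×ˢ Icc 1 t ×ˢ Icc 1 t

/-- The values of the variables of a pair on level `i` given by an answer: its clause consists of
the literals of the variables up to `min (s - i) n` that are true under the set of the answer. -/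
def answerVal (n s : ℕ) (ax : Finset ℕ → ℕ) (a : Answer) : RRefVar → Bool
  | .S _ _ _ => true
  | .base (.D i _ ℓ b) => decide (ℓ ≤ min (s - i) n ∧ (b = true ↔ ℓ ∈ a.1))
  | .base (.V i _ ℓ) => decide (ℓ = min (s - i + 1) n)
  | .base (.L _ _ j') => decide (j' = a.2.1)
  | .base (.R _ _ j') => decide (j' = a.2.2)
  | .base (.I _ m) => decide (m = ax a.1)

/-- Some pair has been answered with `c` as a child, which requires the set `A` at `c`. -/
def Demands (n s t : ℕ) (α : PairState Answer) (c : ℕ × ℕ) (A : Finset ℕ) : Prop :=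
  ∃ i ∈ Icc 2 s, ∃ j ∈ Icc 1 t, ∃ a, α (i, j) = some a ∧
    ((c = (i - 1, a.2.1) ∧ A = insert (min (s - i + 1) n) a.1) ∨
      (c = (i - 1, a.2.2) ∧ A = a.1.erase (min (s - i + 1) n)))

/-- The states reached by the strategy. -/
structure Admissible (k n s t : ℕ) (ω : Finset RRefVar) (α : PairState Answer) : Prop where
  selected : ∀ p a, α p = some a → Selected k ω p
  mem : ∀ p a, α p = some a → a ∈ answers n t
  demand_selected : ∀ c A, Demands n s t α c A → Selected k ω c
  demand_answer : ∀ c A b, Demands n s t α c A → α c = some b → b.1 = A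
  demand_unique : ∀ c A A', Demands n s t α c A → Demands n s t α c A' → A = A'

section Adversary

variable {k n r s t : ℕ} {ω : Finset RRefVar} {α β : PairState Answer} {ax : Finset ℕ → ℕ}

lemma Demands.mono {c : ℕ × ℕ} {A : Finset ℕ} (h : Demands n s t α c A) (he : Extends β α) :
    Demands n s t β c A :=
  let ⟨i, hi, j, hj, a, ha, h⟩ := h
  ⟨i, hi, j, hj, a, he _ _ ha, h⟩

lemma admissible_none : Admissible k n s t ω fun _ => none := by
  constructor <;> simp [Demands]

lemma Admissible.restrict (h : Admissible k n s t ω β) (he : Extends β α) :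
    Admissible k n s t ω α where
  selected p a ha := h.selected p a (he _ _ ha)
  mem p a ha := h.mem p a (he _ _ ha)
  demand_selected c A hc := h.demand_selected c A (hc.mono he)
  demand_answer c A b hc hb := h.demand_answer c A b (hc.mono he) (he _ _ hb)
  demand_unique c A A' hc hc' := h.demand_unique c A A' (hc.mono he) (hc'.mono he)

lemma answerVal_selector (a : Answer) (v : RRefVar) (hv : IsSelector k v) :
    answerVal n s ax a v = true := by
  obtain ⟨u, -, h⟩ := hv
  rw [h]
  rfl

/-- There are two selected pairs on level `i` that are neither answered nor children of an answered
pair. -/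
lemma exists_fresh_children {c i : ℕ} (hα : DomLE α c)
    (hlev : 2 * c + 2 ≤ ((Icc 1 t).filter fun j => Selected k ω (i, j)).card) :
    ∃ l ∈ Icc 1 t, ∃ r ∈ Icc 1 t, l ≠ r ∧ ∀ x, x = l ∨ x = r →
      Selected k ω (i, x) ∧ α (i, x) = none ∧
        ∀ j a, α (i + 1, j) = some a → x ≠ a.2.1 ∧ x ≠ a.2.2 := by
  obtain ⟨D, hD, hdom⟩ := hα
  let f : ℕ × ℕ → Finset ℕ := fun p =>
    if p.1 = i then {p.2} else (α p).elim ∅ fun a => {a.2.1, a.2.2}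
  have hf : ∀ p, (f p).card ≤ 2 := by
    intro p
    simp only [f]
    split_ifs
    · simp
    · cases α p with
      | none => simp
      | some a => exact card_le_two
  have hcard : (D.biUnion f).card ≤ 2 * c := by
    refine (card_biUnion_le_card_mul D f 2 fun p _ => hf p).trans ?_
    lia
  have h2 : 1 < ((((Icc 1 t).filter fun j => Selected k ω (i, j))) \ D.biUnion f).card := by
    have := le_card_sdiff (D.biUnion f) ((Icc 1 t).filter fun j => Selected k ω (i, j))
    lia
  obtain ⟨l, hl, r, hr, hlr⟩ := one_lt_card.1 h2
  have hfresh : ∀ x ∈ (((Icc 1 t).filter fun j => Selected k ω (i, j))) \ D.biUnion f,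
      x ∈ Icc 1 t ∧ Selected k ω (i, x) ∧ α (i, x) = none ∧
        ∀ j a, α (i + 1, j) = some a → x ≠ a.2.1 ∧ x ≠ a.2.2 := by
    intro x hx
    obtain ⟨hx, hxf⟩ := mem_sdiff.1 hx
    obtain ⟨hxt, hxs⟩ := mem_filter.1 hx
    refine ⟨hxt, hxs, ?_, fun j a ha => ?_⟩
    · by_contra h
      exact hxf (mem_biUnion.2 ⟨_, hdom _ h, by simp [f]⟩)
    · by_contra h
      refine hxf (mem_biUnion.2 ⟨(i + 1, j), hdom _ (by simp [ha]), ?_⟩)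
      simp only [f, ha, Option.elim_some]
      rw [if_neg (by simp)]
      simp only [mem_insert, mem_singleton]
      tauto
  exact ⟨l, (hfresh l hl).1, r, (hfresh r hr).1, hlr, fun x hx =>
    hx.elim (fun h => h ▸ (hfresh l hl).2) (fun h => h ▸ (hfresh r hr).2)⟩

lemma Admissible.exists_demanded (h : Admissible k n s t ω α) (hn : 1 ≤ n) (p : ℕ × ℕ) :
    ∃ A ⊆ Icc 1 n, ∀ B, Demands n s t α p B → B = A := by
  by_cases hp : ∃ A, Demands n s t α p A
  · obtain ⟨A, hA⟩ := hp
    refine ⟨A, ?_, fun B hB => h.demand_unique p B A hB hA⟩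
    obtain ⟨i, hi, j, hj, a, ha, hA⟩ := hA
    have hmem := h.mem _ _ ha
    rw [answers, mem_product, mem_powerset] at hmem
    obtain ⟨-, rfl⟩ | ⟨-, rfl⟩ := hA
    · refine insert_subset ?_ hmem.1
      simp only [mem_Icc]
      lia
    · exact (erase_subset _ _).trans hmem.1
  · exact ⟨∅, empty_subset _, fun B hB => absurd ⟨B, hB⟩ hp⟩

lemma forall_update_some {Q : ℕ × ℕ → Answer → Prop} {p : ℕ × ℕ} {a : Answer}
    (h : ∀ q b, α q = some b → Q q b) (hp : Q p a) :
    ∀ q b, Function.update α p (some a) q = some b → Q q b := by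
  intro q b hq
  by_cases hqp : q = p
  · subst hqp
    rw [Function.update_self, Option.some_inj] at hq
    exact hq ▸ hp
  · rw [Function.update_of_ne hqp] at hq
    exact h q b hq

lemma demands_update {p c : ℕ × ℕ} {a : Answer} {B : Finset ℕ}
    (h : Demands n s t (Function.update α p (some a)) c B) :
    Demands n s t α c B ∨ (p.1 ∈ Icc 2 s ∧ p.2 ∈ Icc 1 t ∧
      ((c = (p.1 - 1, a.2.1) ∧ B = insert (min (s - p.1 + 1) n) a.1) ∨
        (c = (p.1 - 1, a.2.2) ∧ B = a.1.erase (min (s - p.1 + 1) n)))) := by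
  obtain ⟨i, hi, j, hj, b, hb, h⟩ := h
  by_cases hp : (i, j) = p
  · subst hp
    rw [Function.update_self, Option.some_inj] at hb
    subst hb
    exact Or.inr ⟨hi, hj, h⟩
  · rw [Function.update_of_ne hp] at hb
    exact Or.inl ⟨i, hi, j, hj, b, hb, h⟩

theorem Admissible.exists_answer (h : Admissible k n s t ω α) (hn : 1 ≤ n) (ht : 1 ≤ t) {c : ℕ}
    (hα : DomLE α c)
    (hlev : ∀ i ∈ Icc 1 (s - 1), 2 * c + 2 ≤ ((Icc 1 t).filter fun j => Selected k ω (i, j)).card)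
    {p : ℕ × ℕ} (hp : Selected k ω p) (hαp : α p = none) :
    ∃ a ∈ answers n t, Admissible k n s t ω (Function.update α p (some a)) := by
  obtain ⟨A, hA, hAp⟩ := h.exists_demanded hn p
  obtain ⟨i, j⟩ := p
  by_cases hin : i ∈ Icc 2 s ∧ j ∈ Icc 1 t
  · obtain ⟨hi, hj⟩ := hin
    obtain ⟨i, rfl⟩ : ∃ i', i = i' + 1 := ⟨i - 1, by have := (mem_Icc.1 hi).1; lia⟩
    rw [mem_Icc] at hi
    obtain ⟨l, hl, r, hr, hlr, hlr'⟩ :=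
      exists_fresh_children hα (hlev i (mem_Icc.2 ⟨by lia, by lia⟩))
    have hchild : ∀ x, x = l ∨ x = r → ∀ B, ¬ Demands n s t α (i, x) B := by
      rintro x hx B ⟨i', hi', j', hj', a, ha, hh⟩
      have hi2 := (mem_Icc.1 hi').1
      have hii : i' = i + 1 := by
        obtain ⟨h, -⟩ | ⟨h, -⟩ := hh <;> rw [Prod.mk.injEq] at h <;> lia
      subst hii
      have := (hlr' x hx).2.2 j' a ha
      simp only [Prod.mk.injEq] at hh
      tauto
    have hnew : ∀ x B, ((x = (i + 1 - 1, l) ∧ B = insert (min (s - (i + 1) + 1) n) A) ∨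
        (x = (i + 1 - 1, r) ∧ B = A.erase (min (s - (i + 1) + 1) n))) →
        ∃ y, (y = l ∨ y = r) ∧ x = (i, y) := by
      rintro x B (⟨rfl, -⟩ | ⟨rfl, -⟩)
      · exact ⟨l, Or.inl rfl, rfl⟩
      · exact ⟨r, Or.inr rfl, rfl⟩
    have hmem : (A, l, r) ∈ answers n t := by
      simp only [answers, mem_product, mem_powerset]
      exact ⟨hA, hl, hr⟩
    refine ⟨(A, l, r), hmem, forall_update_some h.selected hp, forall_update_some h.mem hmem,
      ?_, ?_, ?_⟩
    · intro x B hx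
      obtain hx | ⟨-, -, hx⟩ := demands_update hx
      · exact h.demand_selected x B hx
      · obtain ⟨y, hy, rfl⟩ := hnew x B hx
        exact (hlr' y hy).1
    · intro x B b hx hb
      by_cases hxp : x = (i + 1, j)
      · subst hxp
        rw [Function.update_self, Option.some_inj] at hb
        subst hb
        obtain hx | ⟨-, -, hx⟩ := demands_update hx
        · exact (hAp B hx).symm
        · obtain ⟨y, -, hy⟩ := hnew _ B hx
          simp at hy
      · rw [Function.update_of_ne hxp] at hb
        obtain hx | ⟨-, -, hx⟩ := demands_update hx
        · exact h.demand_answer x B b hx hb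
        · obtain ⟨y, hy, rfl⟩ := hnew x B hx
          simp [(hlr' y hy).2.1] at hb
    · intro x B B' hx hx'
      obtain hx | ⟨-, -, hx⟩ := demands_update hx <;>
        obtain hx' | ⟨-, -, hx'⟩ := demands_update hx'
      · exact h.demand_unique x B B' hx hx'
      · obtain ⟨y, hy, rfl⟩ := hnew x B' hx'
        exact absurd hx (hchild y hy B)
      · obtain ⟨y, hy, rfl⟩ := hnew x B hx
        exact absurd hx' (hchild y hy B')
      · obtain ⟨e, rfl⟩ | ⟨e, rfl⟩ := hx <;> obtain ⟨e', rfl⟩ | ⟨e', rfl⟩ := hx' <;>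
          rw [e] at e' <;> simp_all
  · have hdem : ∀ {x B}, Demands n s t (Function.update α (i, j) (some (A, 1, 1))) x B →
        Demands n s t α x B := fun hx =>
      (demands_update hx).resolve_right fun hx => hin ⟨hx.1, hx.2.1⟩
    have ht1 : 1 ∈ Icc 1 t := mem_Icc.2 ⟨le_rfl, ht⟩
    have hmem : (A, 1, 1) ∈ answers n t := by
      simp only [answers, mem_product, mem_powerset]
      exact ⟨hA, ht1, ht1⟩
    refine ⟨(A, 1, 1), hmem, forall_update_some h.selected hp, forall_update_some h.mem hmem,
      ?_, ?_, ?_⟩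
    · exact fun x B hx => h.demand_selected x B (hdem hx)
    · intro x B b hx hb
      by_cases hxp : x = (i, j)
      · subst hxp
        rw [Function.update_self, Option.some_inj] at hb
        subst hb
        exact (hAp B (hdem hx)).symm
      · rw [Function.update_of_ne hxp] at hb
        exact h.demand_answer x B b (hdem hx) hb
    · exact fun x B B' hx hx' => h.demand_unique x B B' (hdem hx) (hdem hx')

lemma selected_of_falsified_sneg {i j : ℕ}
    (h : ∀ l ∈ Sneg k i j, litFalsP (pval k (answerVal n s ax) ω α) l) : Selected k ω (i, j) := by
  by_contra hs
  refine hs fun u hu => ?_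
  have := h _ (mem_image_of_mem _ hu)
  rw [litFalsP, pval_of_not_selected hs] at this
  simpa using this

/-- The value of a variable of a selected pair is only determined by an answer. -/
lemma exists_answer_of_pval {v : RefVar} {b : Bool} (hs : Selected k ω v.homePair)
    (h : pval k (answerVal n s ax) ω α (.base v) = some b) :
    ∃ a, α v.homePair = some a ∧ answerVal n s ax a (.base v) = b := by
  cases ha : α v.homePair with
  | some a =>
    rw [pval_of_answer hs ha, Option.some_inj] at h
    exact ⟨a, rfl, h⟩
  | none =>
    have hsel : ¬ IsSelector k (.base v) := by
      rintro ⟨u, -, hu⟩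
      exact RRefVar.noConfusion hu
    simp [pval, RRefVar.homePair, hs, ha, hsel] at h

lemma pval_S_ne_false {u i j : ℕ} (hs : Selected k ω (i, j)) (hu : u ∈ Icc 1 k) :
    pval k (answerVal n s ax) ω α (.S u i j) ≠ some false := by
  rw [pval_selector answerVal_selector hs ⟨u, hu, rfl⟩]
  simp

theorem Admissible.not_falsified {Cm : ℕ → Clause ℕ} (h : Admissible k n s t ω α) (hn : 1 ≤ n)
    (hns : n + 1 ≤ s) (hst : Selected k ω (s, t))
    (hax : ∀ A, ax A ∈ Icc 1 r ∧ ∀ l ∈ Cm (ax A), (l.pos = true ↔ l.var ∈ A))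
    {E : Clause RRefVar} (hE : RRefClause Cm n r s t k E) :
    ¬ ∀ l ∈ E, litFalsP (pval k (answerVal n s ax) ω α) l := by
  intro hf
  have hsel : ∀ {i j : ℕ} {C : Clause RRefVar},
      (∀ l ∈ Sneg k i j ∪ C, litFalsP (pval k (answerVal n s ax) ω α) l) →
      Selected k ω (i, j) ∧ ∀ l ∈ C, litFalsP (pval k (answerVal n s ax) ω α) l :=
    fun hf => ⟨selected_of_falsified_sneg fun l hl => hf l (mem_union_left _ hl),
      fun l hl => hf l (mem_union_right _ hl)⟩
  have hval : ∀ {i j : ℕ} {C : Clause RRefVar} {v : RefVar} {b : Bool}, Selected k ω (i, j) →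
      (∀ l ∈ C, litFalsP (pval k (answerVal n s ax) ω α) l) → (⟨.base v, b⟩ : Lit RRefVar) ∈ C →
      v.homePair = (i, j) → ∃ a, α (i, j) = some a ∧ answerVal n s ax a (.base v) = !b := by
    intro i j C v b hs hC hl hv
    rw [← hv] at hs ⊢
    exact exists_answer_of_pval hs (hC _ hl)
  have hanswer : ∀ {i j : ℕ} {C : Clause RRefVar} {v : RefVar} {b : Bool} {a : Answer},
      Selected k ω (i, j) → α (i, j) = some a →
      (∀ l ∈ C, litFalsP (pval k (answerVal n s ax) ω α) l) → (⟨.base v, b⟩ : Lit RRefVar) ∈ C →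
      v.homePair = (i, j) → answerVal n s ax a (.base v) = !b := by
    intro i j C v b a hs ha hC hl hv
    obtain ⟨a', ha', hv⟩ := hval hs hC hl hv
    rw [ha, Option.some_inj] at ha'
    rwa [ha']
  have hleft : ∀ {i j : ℕ} {a : Answer}, i ∈ Icc 2 s → j ∈ Icc 1 t → α (i, j) = some a →
      Demands n s t α (i - 1, a.2.1) (insert (min (s - i + 1) n) a.1) :=
    fun hi hj ha => ⟨_, hi, _, hj, _, ha, Or.inl ⟨rfl, rfl⟩⟩
  have hright : ∀ {i j : ℕ} {a : Answer}, i ∈ Icc 2 s → j ∈ Icc 1 t → α (i, j) = some a →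
      Demands n s t α (i - 1, a.2.2) (a.1.erase (min (s - i + 1) n)) :=
    fun hi hj ha => ⟨_, hi, _, hj, _, ha, Or.inr ⟨rfl, rfl⟩⟩
  have hdom : ∀ {i j m : ℕ} {v : ℕ → RefVar}, Selected k ω (i, j) → 1 ≤ m →
      (∀ l ∈ (Icc 1 m).image fun x => (⟨.base (v x), true⟩ : Lit RRefVar),
        litFalsP (pval k (answerVal n s ax) ω α) l) →
      (∀ x, (v x).homePair = (i, j)) → ∃ a ∈ answers n t, α (i, j) = some a ∧
        ∀ x ∈ Icc 1 m, answerVal n s ax a (.base (v x)) = false := by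
    intro i j m v hs hm hC hv
    obtain ⟨a, ha, -⟩ := hval hs hC
      (mem_image_of_mem _ (mem_Icc.2 ⟨le_rfl, hm⟩)) (hv 1)
    exact ⟨a, h.mem _ _ ha, ha, fun x hx =>
      hanswer hs ha hC (mem_image_of_mem _ hx) (hv x)⟩
  cases hE with
  | ax hj hm hℓ hmem =>
    obtain ⟨hs, hf⟩ := hsel hf
    obtain ⟨a, ha, hI⟩ := hval hs hf (mem_insert_self _ _) rfl
    have hD := hanswer hs ha hf (mem_insert_of_mem (mem_singleton_self _)) rfl
    simp only [answerVal, Bool.not_false, decide_eq_true_eq] at hI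
    subst hI
    have := (hax a.1).2 _ hmem
    simp only [answerVal, Bool.not_true, decide_eq_false_iff_not] at hD
    refine hD ⟨?_, this⟩
    have := (mem_Icc.1 hℓ).2
    lia
  | nontaut hi hj hℓ =>
    obtain ⟨hs, hf⟩ := hsel hf
    obtain ⟨a, ha, h1⟩ := hval hs hf (mem_insert_self _ _) rfl
    have h2 := hanswer hs ha hf (mem_insert_of_mem (mem_singleton_self _)) rfl
    simp [answerVal] at h1 h2
    tauto
  | lcut hi hj hj' hℓ =>
    obtain ⟨hs, hf⟩ := hsel hf
    obtain ⟨a, ha, h1⟩ := hval hs hf (mem_insert_self _ _) rfl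
    have h2 := hanswer hs ha hf (mem_insert_of_mem (mem_insert_self _ _)) rfl
    simp [answerVal] at h1 h2
    subst h1 h2
    have hd := hleft hi hj ha
    obtain ⟨b, hb, h3⟩ := hval (h.demand_selected _ _ hd) hf (mem_insert_of_mem
      (mem_insert_of_mem (mem_singleton_self _))) rfl
    have := h.demand_answer _ _ b hd hb
    have hi' := mem_Icc.1 hi
    simp [answerVal, this] at h3
    lia
  | rcut hi hj hj' hℓ =>
    obtain ⟨hs, hf⟩ := hsel hf
    obtain ⟨a, ha, h1⟩ := hval hs hf (mem_insert_self _ _) rfl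
    have h2 := hanswer hs ha hf (mem_insert_of_mem (mem_insert_self _ _)) rfl
    simp [answerVal] at h1 h2
    subst h1 h2
    have hd := hright hi hj ha
    obtain ⟨b, hb, h3⟩ := hval (h.demand_selected _ _ hd) hf (mem_insert_of_mem
      (mem_insert_of_mem (mem_singleton_self _))) rfl
    have := h.demand_answer _ _ b hd hb
    have hi' := mem_Icc.1 hi
    simp [answerVal, this] at h3
    lia
  | @ltransf i j j' ℓ ℓ' b hi hj hj' hℓ hℓ' hne =>
    obtain ⟨hs, hf⟩ := hsel hf
    obtain ⟨a, ha, h1⟩ := hval hs hf (mem_insert_self _ _) rfl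
    have h2 := hanswer hs ha hf (mem_insert_of_mem (mem_insert_self _ _)) rfl
    have h4 := hanswer hs ha hf (mem_insert_of_mem (mem_insert_of_mem (mem_insert_of_mem
      (mem_singleton_self _)))) rfl
    simp [answerVal] at h1 h2 h4
    subst h1 h2
    have hd := hleft hi hj ha
    obtain ⟨b', hb', h3⟩ := hval (h.demand_selected _ _ hd) hf (mem_insert_of_mem
      (mem_insert_of_mem (mem_insert_self _ _))) rfl
    have := h.demand_answer _ _ b' hd hb'
    have hi' := mem_Icc.1 hi
    simp [answerVal, this] at h3
    by_cases hℓd : ℓ' = min (s - i + 1) n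
    · simp [hℓd] at h3 hne
      simp [hne] at h3
    · simp only [hℓd] at h3
      exact h4 (by lia) (by lia) h3.2
  | @rtransf i j j' ℓ ℓ' b hi hj hj' hℓ hℓ' hne =>
    obtain ⟨hs, hf⟩ := hsel hf
    obtain ⟨a, ha, h1⟩ := hval hs hf (mem_insert_self _ _) rfl
    have h2 := hanswer hs ha hf (mem_insert_of_mem (mem_insert_self _ _)) rfl
    have h4 := hanswer hs ha hf (mem_insert_of_mem (mem_insert_of_mem (mem_insert_of_mem
      (mem_singleton_self _)))) rfl
    simp [answerVal] at h1 h2 h4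
    subst h1 h2
    have hd := hright hi hj ha
    obtain ⟨b', hb', h3⟩ := hval (h.demand_selected _ _ hd) hf (mem_insert_of_mem
      (mem_insert_of_mem (mem_insert_self _ _))) rfl
    have := h.demand_answer _ _ b' hd hb'
    have hi' := mem_Icc.1 hi
    simp [answerVal, this] at h3
    by_cases hℓd : ℓ' = min (s - i + 1) n
    · simp [hℓd] at h3 hne
      simp [hne] at h3
    · simp only [hℓd] at h3
      exact h4 (by lia) (by lia) h3.2
  | empty hℓ =>
    obtain ⟨hs, hf⟩ := hsel hf
    obtain ⟨a, ha, h1⟩ := hval hs hf (mem_singleton_self _) rfl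
    have hℓ' := mem_Icc.1 hℓ
    simp [answerVal] at h1
    lia
  | @vdom i j hi hj =>
    obtain ⟨hs, hf⟩ := hsel hf
    obtain ⟨a, ha, hαa, h1⟩ := hdom hs hn hf fun _ => rfl
    have := h1 (min (s - i + 1) n) (mem_Icc.2 ⟨by lia, by lia⟩)
    simp [answerVal] at this
  | idom hj =>
    obtain ⟨hs, hf⟩ := hsel hf
    have hr := mem_Icc.1 (hax ∅).1
    obtain ⟨a, ha, hαa, h1⟩ := hdom hs (hr.1.trans hr.2) hf fun _ => rfl
    have := h1 (ax a.1) (hax a.1).1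
    simp [answerVal] at this
  | ldom hi hj =>
    obtain ⟨hs, hf⟩ := hsel hf
    have ht := mem_Icc.1 hj
    obtain ⟨a, ha, hαa, h1⟩ := hdom hs (ht.1.trans ht.2) hf fun _ => rfl
    simp only [answers, mem_product] at ha
    have := h1 a.2.1 ha.2.1
    simp [answerVal] at this
  | rdom hi hj =>
    obtain ⟨hs, hf⟩ := hsel hf
    have ht := mem_Icc.1 hj
    obtain ⟨a, ha, hαa, h1⟩ := hdom hs (ht.1.trans ht.2) hf fun _ => rfl
    simp only [answers, mem_product] at ha
    have := h1 a.2.2 ha.2.2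
    simp [answerVal] at this
  | vfunc hi hj hℓ hℓ' hne =>
    obtain ⟨hs, hf⟩ := hsel hf
    obtain ⟨a, ha, h1⟩ := hval hs hf (mem_insert_self _ _) rfl
    have h2 := hanswer hs ha hf (mem_insert_of_mem (mem_singleton_self _)) rfl
    simp [answerVal] at h1 h2
    exact hne (h1.trans h2.symm)
  | ifunc hj hm hm' hne =>
    obtain ⟨hs, hf⟩ := hsel hf
    obtain ⟨a, ha, h1⟩ := hval hs hf (mem_insert_self _ _) rfl
    have h2 := hanswer hs ha hf (mem_insert_of_mem (mem_singleton_self _)) rfl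
    simp [answerVal] at h1 h2
    exact hne (h1.trans h2.symm)
  | lfunc hi hj hj' hj'' hne =>
    obtain ⟨hs, hf⟩ := hsel hf
    obtain ⟨a, ha, h1⟩ := hval hs hf (mem_insert_self _ _) rfl
    have h2 := hanswer hs ha hf (mem_insert_of_mem (mem_singleton_self _)) rfl
    simp [answerVal] at h1 h2
    exact hne (h1.trans h2.symm)
  | rfunc hi hj hj' hj'' hne =>
    obtain ⟨hs, hf⟩ := hsel hf
    obtain ⟨a, ha, h1⟩ := hval hs hf (mem_insert_self _ _) rfl
    have h2 := hanswer hs ha hf (mem_insert_of_mem (mem_singleton_self _)) rfl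
    simp [answerVal] at h1 h2
    exact hne (h1.trans h2.symm)
  | sTrue hu => exact pval_S_ne_false hst hu (hf _ (mem_singleton_self _))
  | lUnused hi hj hj' hu' =>
    obtain ⟨hs, hf⟩ := hsel hf
    obtain ⟨a, ha, h1⟩ := hval hs hf (mem_insert_self _ _) rfl
    simp [answerVal] at h1
    subst h1
    exact pval_S_ne_false (h.demand_selected _ _ (hleft hi hj ha)) hu'
      (hf _ (mem_insert_of_mem (mem_singleton_self _)))
  | rUnused hi hj hj' hu' =>
    obtain ⟨hs, hf⟩ := hsel hf
    obtain ⟨a, ha, h1⟩ := hval hs hf (mem_insert_self _ _) rfl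
    simp [answerVal] at h1
    subst h1
    exact pval_S_ne_false (h.demand_selected _ _ (hright hi hj ha)) hu'
      (hf _ (mem_insert_of_mem (mem_singleton_self _)))

lemma exists_falsified_clause {Cm : ℕ → Clause ℕ}
    (hF : Unsat {E : Clause ℕ | ∃ m ∈ Icc 1 r, E = Cm m}) (A : Finset ℕ) :
    ∃ m, m ∈ Icc 1 r ∧ ∀ l ∈ Cm m, (l.pos = true ↔ l.var ∈ A) := by
  by_contra hA
  push Not at hA
  refine hF ⟨fun x => decide (x ∉ A), ?_⟩
  rintro E ⟨m, hm, rfl⟩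
  obtain ⟨l, hl, h⟩ := hA m hm
  refine ⟨l, hl, ?_⟩
  cases hb : l.pos <;> simp_all

/-- There is no refutation all of whose lines are decided by shallow trees under a selection with
sufficiently many selected pairs on each level. -/
theorem not_refutation_of_decidedWithin {Cm : ℕ → Clause ℕ} {P : List (Dnf RRefVar)} {h : ℕ}
    (hn : 1 ≤ n) (ht : 1 ≤ t) (hns : n + 1 ≤ s) (hst : Selected k ω (s, t))
    (hax : ∀ A, ax A ∈ Icc 1 r ∧ ∀ l ∈ Cm (ax A), (l.pos = true ↔ l.var ∈ A))
    (hlev : ∀ i ∈ Icc 1 (s - 1), 6 * h ≤ ((Icc 1 t).filter fun j => Selected k ω (i, j)).card)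
    (hdec : ∀ G ∈ P,
      DecidedWithin k (answerVal n s ax) (answers n t) ω G h fun _ => none) :
    ¬ IsResKRefutation k {E | RRefClause Cm n r s t k E} P :=
  not_refutation_of_strategy (Adm := Admissible k n s t ω) answerVal_selector admissible_none
    (fun _ _ hβ he => hβ.restrict he) (fun _ hα => hα.mem)
    (fun _ c hα hc hch _ hp hαp => hα.exists_answer hn ht hc
      (fun i hi => by have := hlev i hi; lia) hp hαp)
    (fun _ hα _ hE => hα.not_falsified hn hns hst hax hE) hdec

end Adversary

/-! ### The union bound -/

lemma pr_selected {k : ℕ} {W : Finset RRefVar} {p : ℕ × ℕ}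
    (hW : ∀ u ∈ Icc 1 k, RRefVar.S u p.1 p.2 ∈ W) :
    pr W (fun ω => Selected k ω p) = (1 / 2) ^ k := by
  have hinj : Function.Injective fun u => RRefVar.S u p.1 p.2 :=
    fun u u' h => (RRefVar.S.inj h).1
  have hcard : ((Icc 1 k).image fun u => RRefVar.S u p.1 p.2).card = k := by
    rw [card_image_of_injective _ hinj, Nat.card_Icc, Nat.add_sub_cancel]
  have hsub : ((Icc 1 k).image fun u => RRefVar.S u p.1 p.2) ⊆ W := by
    intro v hv
    obtain ⟨u, hu, rfl⟩ := mem_image.1 hv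
    exact hW u hu
  have h := pr_agree hsub fun _ => True
  rw [hcard] at h
  rw [← h]
  congr 1
  ext ω
  simp only [Selected, forall_mem_image, iff_true]

/-- Few pairs on a given level are selected with exponentially small probability. -/
lemma pr_few_selected_le {k t i : ℕ} {W : Finset RRefVar}
    (hW : ∀ j ∈ Icc 1 t, ∀ u ∈ Icc 1 k, RRefVar.S u i j ∈ W) :
    pr W (fun ω => (((Icc 1 t).filter fun j => Selected k ω (i, j)).card : ℝ) < t / 2 ^ (k + 1)) ≤
      Real.exp (-((1 - Real.log 2) * (t / 2 ^ (k + 1)))) := by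
  set T : ℝ := t / 2 ^ (k + 1) with hT
  have havg : ∀ j ∈ Icc 1 t, avg W (fun ω => 1 - 1 / 2 * ind (Selected k ω (i, j)))
      = 1 - 1 / 2 ^ (k + 1) := by
    intro j hj
    rw [avg_sub, avg_const, avg_mul_left]
    have : avg W (fun ω => ind (Selected k ω (i, j))) = (1 / 2) ^ k := pr_selected (hW j hj)
    rw [this, one_div_pow, pow_succ]
    field_simp
  calc pr W (fun ω => (((Icc 1 t).filter fun j => Selected k ω (i, j)).card : ℝ) < T)
      ≤ avg W (fun ω => (2 : ℝ) ^ T * ∏ j ∈ Icc 1 t, (1 - 1 / 2 * ind (Selected k ω (i, j)))) := by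
        refine avg_mono fun ω _ => ?_
        have hprod : ∏ j ∈ Icc 1 t, (1 - 1 / 2 * ind (Selected k ω (i, j)))
            = (2 : ℝ) ^ (-(((Icc 1 t).filter fun j => Selected k ω (i, j)).card : ℝ)) := by
          rw [Real.rpow_neg two_pos.le, Real.rpow_natCast, ← inv_pow, ← prod_const, prod_filter]
          refine prod_congr rfl fun j _ => ?_
          by_cases h : Selected k ω (i, j) <;> simp [ind, h]
          norm_num
        rw [hprod, ← Real.rpow_add two_pos]
        by_cases h : (((Icc 1 t).filter fun j => Selected k ω (i, j)).card : ℝ) < T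
        · rw [ind_true h]
          exact Real.one_le_rpow one_le_two (by linarith)
        · rw [ind_false h]
          positivity
    _ = (2 : ℝ) ^ T * (1 - 1 / 2 ^ (k + 1)) ^ t := by
        rw [avg_mul_left, avg_prod (Icc 1 t) (fun j => {v | v.homePair = (i, j)})
          (fun j ω => 1 - 1 / 2 * ind (Selected k ω (i, j))), prod_congr rfl havg, prod_const,
          Nat.card_Icc, Nat.add_sub_cancel]
        · intro j _ j' _ hjj
          refine Set.disjoint_left.2 fun v (hv : _ = _) (hv' : _ = _) => hjj ?_
          simpa using hv.symm.trans hv'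
        · intro j _ A B h
          have : Selected k A (i, j) ↔ Selected k B (i, j) :=
            forall₂_congr fun u _ => h (.S u i j) rfl
          simp only [this]
    _ ≤ Real.exp (T * Real.log 2) * Real.exp (-(1 / 2 ^ (k + 1))) ^ t := by
        rw [Real.rpow_def_of_pos two_pos, mul_comm (Real.log 2)]
        have h1 : (1 : ℝ) / 2 ^ (k + 1) ≤ 1 :=
          div_le_one_of_le₀ (one_le_pow₀ one_le_two) (by positivity)
        gcongr
        exact Real.one_sub_le_exp_neg _
    _ = Real.exp (-((1 - Real.log 2) * T)) := by
        rw [← Real.exp_nat_mul, ← Real.exp_add, hT]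
        congr 1
        ring

theorem length_bound_of_heights {k n r s t : ℕ} {Cm : ℕ → Clause ℕ} {P : List (Dnf RRefVar)}
    (hk : 1 ≤ k) (hn : 1 ≤ n) (hns : n + 1 ≤ s) (hst : s ≤ t)
    (hF : Unsat {E : Clause ℕ | ∃ m ∈ Icc 1 r, E = Cm m})
    (hP : IsResKRefutation k {E | RRefClause Cm n r s t k E} P)
    (m : ℕ → ℕ) (ε : ℕ → ℝ) (hε : ∀ j, 0 ≤ ε j)
    (hdisj : ∀ j < k, (1 - (1 / 4 : ℝ) ^ (j + 1)) ^ m (j + 1) ≤ ε (j + 1))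
    (hcover : ∀ j < k, ((answers n t).card : ℝ) ^ ((j + 1) * m (j + 1)) * ε j ≤ ε (j + 1))
    (hheight : 6 * (treeHeight m k : ℝ) ≤ t / 2 ^ (k + 1)) :
    (1 / 2 : ℝ) ^ k ≤
      P.length * ε k + t * Real.exp (-((1 - Real.log 2) * (t / 2 ^ (k + 1)))) := by
  have ht : 1 ≤ t := by lia
  choose ax hax using exists_falsified_clause hF
  let sel : ℕ × ℕ → Finset RRefVar := fun p => (Icc 1 k).image fun u => .S u p.1 p.2
  let W : Finset RRefVar := (P.toFinset.biUnion fun G => G.biUnion fun q => q.biUnion fun l =>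
    insert l.var (sel l.var.homePair)) ∪ (Icc 1 t ×ˢ Icc 1 t).biUnion sel
  have hWP : ∀ G ∈ P, ∀ q ∈ G, ∀ l ∈ q, ∀ v ∈ insert l.var (sel l.var.homePair), v ∈ W :=
    fun G hG q hq l hl v hv => mem_union_left _ (mem_biUnion.2 ⟨G, List.mem_toFinset.2 hG,
      mem_biUnion.2 ⟨q, hq, mem_biUnion.2 ⟨l, hl, hv⟩⟩⟩)
  have hWS : ∀ i ∈ Icc 1 t, ∀ j ∈ Icc 1 t, ∀ u ∈ Icc 1 k, RRefVar.S u i j ∈ W :=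
    fun i hi j hj u hu => mem_union_right _ (mem_biUnion.2 ⟨(i, j), mem_product.2 ⟨hi, hj⟩,
      mem_image_of_mem _ hu⟩)
  have hΛ : 1 ≤ (answers n t).card := by
    refine card_pos.2 ⟨(∅, 1, 1), ?_⟩
    simp only [answers, mem_product, mem_powerset]
    exact ⟨empty_subset _, mem_Icc.2 ⟨le_rfl, ht⟩, mem_Icc.2 ⟨le_rfl, ht⟩⟩
  have hline : ∀ G ∈ P.toFinset, pr W (fun ω => ¬ DecidedWithin k (answerVal n s ax) (answers n t)
      ω G (treeHeight m k) fun _ => none) ≤ ε k := by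
    intro G hG
    have hG := List.mem_toFinset.1 hG
    have hmix : ∀ ω : Finset RRefVar, mix (homeIn ∅) ∅ ω = ω := by
      intro ω
      ext v
      rw [mem_mix_of_notMem]
      exact notMem_empty _
    have := pr_not_decidedWithin_le hk (answerVal_selector (n := n) (s := s) (ax := ax)) hΛ
      (hP.2.2.1 G hG)
      (fun q hq l hl => ⟨hWP G hG q hq l hl _ (mem_insert_self _ _),
        fun u hu => hWP G hG q hq l hl _ (mem_insert_of_mem (mem_image_of_mem _ hu))⟩)
      m ε hε hdisj hcover k le_rfl ∅ (fun _ => none) ∅ (fun _ h => absurd rfl h) (by simp)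
      (fun q hq => Or.inr ((card_filter_le _ _).trans (hP.2.2.1 G hG q hq)))
    simpa only [hmix] using this
  have hlevel : ∀ i ∈ Icc 1 (s - 1), pr W (fun ω =>
      (((Icc 1 t).filter fun j => Selected k ω (i, j)).card : ℝ) < t / 2 ^ (k + 1)) ≤
      Real.exp (-((1 - Real.log 2) * (t / 2 ^ (k + 1)))) := by
    intro i hi
    rw [mem_Icc] at hi
    exact pr_few_selected_le fun j hj u hu => hWS i (mem_Icc.2 ⟨by lia, by lia⟩) j hj u hu
  have hbad : ∀ ω ⊆ W, Selected k ω (s, t) →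
      (∃ G ∈ P.toFinset, ¬ DecidedWithin k (answerVal n s ax) (answers n t)
        ω G (treeHeight m k) fun _ => none) ∨
      ∃ i ∈ Icc 1 (s - 1),
        (((Icc 1 t).filter fun j => Selected k ω (i, j)).card : ℝ) < t / 2 ^ (k + 1) := by
    intro ω _ hω
    by_contra hcon
    push Not at hcon
    refine not_refutation_of_decidedWithin hn ht hns hω hax (fun i hi => ?_)
      (fun G hG => hcon.1 G (List.mem_toFinset.2 hG)) hP
    exact_mod_cast hheight.trans (hcon.2 i hi)
  calc (1 / 2 : ℝ) ^ k = pr W (fun ω => Selected k ω (s, t)) := (pr_selected fun u hu =>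
        hWS s (mem_Icc.2 ⟨by lia, hst⟩) t (mem_Icc.2 ⟨ht, le_rfl⟩) u hu).symm
    _ ≤ _ := (pr_mono hbad).trans (pr_or_le _ _ _)
    _ ≤ (∑ G ∈ P.toFinset, ε k) + ∑ i ∈ Icc 1 (s - 1),
          Real.exp (-((1 - Real.log 2) * (t / 2 ^ (k + 1)))) :=
        add_le_add ((pr_exists_le _ _ _).trans (sum_le_sum hline))
          ((pr_exists_le _ _ _).trans (sum_le_sum hlevel))
    _ ≤ _ := by
        rw [sum_const, sum_const, nsmul_eq_mul, nsmul_eq_mul, Nat.card_Icc]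
        have h1 : (P.toFinset.card : ℝ) ≤ P.length := by exact_mod_cast List.toFinset_card_le P
        have h2 : ((s - 1 + 1 - 1 : ℕ) : ℝ) ≤ t := by exact_mod_cast (by lia)
        have := hε k
        gcongr

lemma card_answers (n t : ℕ) : (answers n t).card = 2 ^ n * t ^ 2 := by
  simp [answers, card_product, sq]

/-! ### Choice of the parameters -/

/-- Formulas reducible to terms of width `i + 1` stay undecided with probability at most
`2 ^ (-levelExponent k n t i)`. -/
noncomputable def levelExponent (k n t : ℕ) : ℕ → ℝ
  | 0 => t / 2 ^ (k + 6)
  | i + 1 => levelExponent k n t i / (2 * n * (i + 2) * 4 ^ (i + 2))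

lemma levelExponent_eq {n : ℕ} (k t i : ℕ) (hn : 1 ≤ n) :
    levelExponent k n t i = t / n ^ i / (2 ^ (i ^ 2 + 4 * i + k + 6) * (i + 1).factorial) := by
  have hn : (n : ℝ) ≠ 0 := by positivity
  induction i with
  | zero => simp [levelExponent]
  | succ i ih =>
    have h4 : (4 : ℝ) ^ (i + 2) = 2 ^ (2 * (i + 2)) := by rw [pow_mul]; norm_num
    have he : (i + 1) ^ 2 + 4 * (i + 1) + k + 6 = (i ^ 2 + 4 * i + k + 6) + (2 * (i + 2) + 1) := by
      ring
    rw [levelExponent, ih, he, h4, Nat.factorial_succ (i + 1), pow_add _ (i ^ 2 + 4 * i + k + 6),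
      pow_succ 2 (2 * (i + 2))]
    push_cast
    field_simp
    ring

lemma mul_levelExponent_succ {n : ℕ} (k t i : ℕ) (hn : 1 ≤ n) :
    2 * n * ((i + 2) * (4 ^ (i + 2) * levelExponent k n t (i + 1))) = levelExponent k n t i := by
  have hn : (n : ℝ) ≠ 0 := by positivity
  rw [levelExponent]
  field_simp

lemma levelExponent_nonneg (k n t i : ℕ) : 0 ≤ levelExponent k n t i := by
  induction i with
  | zero => simp only [levelExponent]; positivity
  | succ i ih => simp only [levelExponent]; positivity

lemma levelExponent_anti (k t : ℕ) {n : ℕ} (hn : 1 ≤ n) : Antitone (levelExponent k n t) := by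
  refine antitone_nat_of_succ_le fun i => div_le_self (levelExponent_nonneg k n t i) ?_
  have h1 : (1 : ℝ) ≤ n := by exact_mod_cast hn
  have h2 : (1 : ℝ) ≤ 4 ^ (i + 2) := one_le_pow₀ (by norm_num)
  have h3 : (1 : ℝ) ≤ (i : ℝ) + 2 := by linarith [(Nat.cast_nonneg i : (0 : ℝ) ≤ i)]
  exact one_le_mul_of_one_le_of_one_le (one_le_mul_of_one_le_of_one_le (by linarith) h3) h2

lemma betaConst_mul_le {k n : ℕ} (t : ℕ) (hk : 1 ≤ k) (hn : 1 ≤ n) :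
    betaConst k * t / (n : ℝ) ^ (k - 1) ≤ levelExponent k n t (k - 1) / 2 := by
  have hlog : Real.logb 2 (Real.exp 1) ≤ 2 := by
    rw [Real.logb_le_iff_le_rpow one_lt_two (Real.exp_pos 1)]
    norm_num
    linarith [Real.exp_one_lt_d9]
  have hlog0 : 0 ≤ Real.logb 2 (Real.exp 1) :=
    Real.logb_nonneg one_lt_two (Real.one_le_exp zero_le_one)
  obtain ⟨i, rfl⟩ : ∃ i, k = i + 1 := ⟨k - 1, by lia⟩
  have hn : (n : ℝ) ≠ 0 := by positivity
  rw [levelExponent_eq _ _ _ (by lia), betaConst, Nat.add_sub_cancel]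
  calc Real.logb 2 (Real.exp 1) ^ (i + 1) /
        (2 ^ ((i + 1) ^ 2 + 4 * (i + 1) + 4) * ((i + 1).factorial : ℝ)) * t / (n : ℝ) ^ i
      ≤ 2 ^ (i + 1) / (2 ^ ((i + 1) ^ 2 + 4 * (i + 1) + 4) * ((i + 1).factorial : ℝ)) * t /
          (n : ℝ) ^ i := by gcongr
    _ = _ := by
      have : (i + 1) ^ 2 + 4 * (i + 1) + 4 = (i ^ 2 + 4 * i + (i + 1) + 6) + 1 + (i + 1) := by
        ring
      rw [this, pow_add _ _ (i + 1), pow_succ 2 (i ^ 2 + 4 * i + (i + 1) + 6)]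
      field_simp

lemma le_levelExponent {k n t : ℕ} (hk : 1 ≤ k) (hn : 1 ≤ n) (hnt : n ^ k ≤ t) :
    n / (2 ^ (k ^ 2 + 3 * k + 8) * k.factorial) ≤ levelExponent k n t (k - 1) := by
  obtain ⟨i, rfl⟩ : ∃ i, k = i + 1 := ⟨k - 1, by lia⟩
  have hn : (0 : ℝ) < n := by positivity
  rw [levelExponent_eq _ _ _ (by lia), Nat.add_sub_cancel]
  have h1 : (n : ℝ) ≤ t / n ^ i := by
    rw [le_div_iff₀ (by positivity), ← pow_succ']
    exact_mod_cast hnt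
  have h2 : i ^ 2 + 4 * i + (i + 1) + 6 ≤ (i + 1) ^ 2 + 3 * (i + 1) + 8 := by nlinarith
  gcongr
  norm_num

lemma one_sub_pow_ceil_le {j : ℕ} {y : ℝ} (hy : 0 ≤ y) :
    (1 - (1 / 4 : ℝ) ^ (j + 1)) ^ ⌈4 ^ (j + 1) * y⌉₊ ≤ 2 ^ (-y) := by
  have h1 : (1 / 4 : ℝ) ^ (j + 1) ≤ 1 := pow_le_one₀ (by norm_num) (by norm_num)
  calc (1 - (1 / 4 : ℝ) ^ (j + 1)) ^ ⌈4 ^ (j + 1) * y⌉₊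
      ≤ Real.exp (-(1 / 4 : ℝ) ^ (j + 1)) ^ ⌈4 ^ (j + 1) * y⌉₊ :=
        pow_le_pow_left₀ (by linarith) (Real.one_sub_le_exp_neg _) _
    _ = Real.exp (-((1 / 4 : ℝ) ^ (j + 1) * ⌈4 ^ (j + 1) * y⌉₊)) := by
        rw [← Real.exp_nat_mul]
        congr 1
        ring
    _ ≤ Real.exp (-y) := by
        have h2 : (1 / 4 : ℝ) ^ (j + 1) * (4 ^ (j + 1) * y) ≤
            (1 / 4 : ℝ) ^ (j + 1) * ⌈4 ^ (j + 1) * y⌉₊ := by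
          gcongr
          exact Nat.le_ceil _
        rw [← mul_assoc, ← mul_pow] at h2
        norm_num at h2
        gcongr
    _ ≤ 2 ^ (-y) := by
        rw [Real.rpow_def_of_pos two_pos]
        gcongr
        nlinarith [Real.log_two_lt_d9]

lemma card_answers_pow_mul_le {k n t i : ℕ} (hn : 1 ≤ n)
    (ht : (t : ℝ) ≤ (2 : ℝ) ^ ((1 / 16 : ℝ) * (n : ℝ))) (hy : 1 ≤ levelExponent k n t (i + 1)) :
    ((answers n t).card : ℝ) ^ ((i + 2) * ⌈4 ^ (i + 2) * levelExponent k n t (i + 1)⌉₊) *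
      2 ^ (-levelExponent k n t i) ≤ 2 ^ (-levelExponent k n t (i + 1)) := by
  set y := levelExponent k n t (i + 1) with hydef
  set q : ℕ := (i + 2) * ⌈4 ^ (i + 2) * y⌉₊ with hq
  have hn1 : (1 : ℝ) ≤ n := by exact_mod_cast hn
  have hM : ((answers n t).card : ℝ) ≤ 2 ^ ((9 / 8 : ℝ) * n) := by
    rw [card_answers]
    push_cast
    calc (2 : ℝ) ^ n * (t : ℝ) ^ 2 ≤ 2 ^ n * ((2 : ℝ) ^ ((1 / 16 : ℝ) * (n : ℝ))) ^ 2 := by gcongr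
      _ = 2 ^ ((9 / 8 : ℝ) * n) := by
        rw [← Real.rpow_natCast, ← Real.rpow_natCast, ← Real.rpow_mul two_pos.le,
          ← Real.rpow_add two_pos]
        congr 1
        push_cast
        ring
  have h4 : (16 : ℝ) ≤ 4 ^ (i + 2) := by
    rw [pow_add]
    linarith [one_le_pow₀ (n := i) (by norm_num : (1 : ℝ) ≤ 4)]
  have hceil : (⌈4 ^ (i + 2) * y⌉₊ : ℝ) ≤ 17 / 16 * (4 ^ (i + 2) * y) := by
    have := (Nat.ceil_lt_add_one (by positivity : 0 ≤ 4 ^ (i + 2) * y)).le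
    nlinarith
  have hi : (2 : ℝ) ≤ i + 2 := by linarith [(Nat.cast_nonneg i : (0 : ℝ) ≤ i)]
  have hyz : 32 * y ≤ n * ((i + 2) * (4 ^ (i + 2) * y)) := by
    have h5 : 16 * y ≤ 4 ^ (i + 2) * y := by gcongr
    have h6 : 2 * (16 * y) ≤ (i + 2) * (4 ^ (i + 2) * y) := by gcongr
    nlinarith
  have hqle : (q : ℝ) ≤ 17 / 16 * ((i + 2) * (4 ^ (i + 2) * y)) := by
    rw [hq]
    push_cast
    calc ((i : ℝ) + 2) * ⌈4 ^ (i + 2) * y⌉₊ ≤ (i + 2) * (17 / 16 * (4 ^ (i + 2) * y)) := by gcongr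
      _ = _ := by ring
  calc ((answers n t).card : ℝ) ^ q * 2 ^ (-levelExponent k n t i)
      ≤ ((2 : ℝ) ^ ((9 / 8 : ℝ) * n)) ^ q * 2 ^ (-levelExponent k n t i) := by gcongr
    _ = (2 : ℝ) ^ ((9 / 8 : ℝ) * n * q - levelExponent k n t i) := by
        rw [← Real.rpow_natCast, ← Real.rpow_mul two_pos.le, ← Real.rpow_add two_pos,
          sub_eq_add_neg]
    _ ≤ 2 ^ (-y) := by
        refine Real.rpow_le_rpow_of_exponent_le one_le_two ?_
        rw [← mul_levelExponent_succ k t i hn, ← hydef]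
        have := mul_le_mul_of_nonneg_left hqle (by positivity : 0 ≤ (9 / 8 : ℝ) * n)
        nlinarith

lemma treeHeight_ceil_le {k n t : ℕ} {m : ℕ → ℕ} (hn : 1 ≤ n)
    (hm : ∀ i, m (i + 1) = ⌈4 ^ (i + 1) * levelExponent k n t i⌉₊) (i : ℕ) :
    (treeHeight m (i + 1) : ℝ) ≤
      t / 2 ^ (k + 4) + i * (t / 2 ^ (k + 4) / (2 * n)) + (i + 1) ^ 2 := by
  have hceil : ∀ i, (m (i + 1) : ℝ) ≤ 4 ^ (i + 1) * levelExponent k n t i + 1 := fun i => by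
    rw [hm]
    have := levelExponent_nonneg k n t i
    exact (Nat.ceil_lt_add_one (by positivity)).le
  have h0 : levelExponent k n t 0 = t / 2 ^ (k + 4) / 4 := by
    rw [levelExponent, pow_add _ k 6, pow_add _ k 4]
    field_simp
    norm_num
  induction i with
  | zero =>
    have := hceil 0
    rw [h0] at this
    norm_num [treeHeight] at this ⊢
    linarith
  | succ i ih =>
    have hn0 : (0 : ℝ) < 2 * n := by positivity
    have hstep : (i + 2) * (4 ^ (i + 2) * levelExponent k n t (i + 1)) ≤
        t / 2 ^ (k + 4) / (2 * n) := by
      rw [le_div_iff₀ hn0, mul_comm, mul_levelExponent_succ k t i hn]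
      refine (levelExponent_anti k t hn i.zero_le).trans ?_
      rw [h0]
      have : (0 : ℝ) ≤ t / 2 ^ (k + 4) := by positivity
      linarith
    have := mul_le_mul_of_nonneg_left (hceil (i + 1)) (by positivity : (0 : ℝ) ≤ i + 2)
    rw [treeHeight]
    push_cast
    have hi : (0 : ℝ) ≤ i := i.cast_nonneg
    nlinarith

lemma mul_exp_neg_le {k t : ℕ} (ht : 2 ^ (3 * k + 8) ≤ t) :
    t * Real.exp (-((1 - Real.log 2) * (t / 2 ^ (k + 1)))) ≤ (1 / 2) ^ (k + 1) := by
  have ht' : (2 : ℝ) ^ (3 * k + 8) ≤ t := by exact_mod_cast ht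
  have ht0 : (0 : ℝ) < t := lt_of_lt_of_le (by positivity) ht'
  set y : ℝ := t / 2 ^ (k + 3) with hy
  have hy0 : 0 < y := by positivity
  have hle : y ≤ (1 - Real.log 2) * (t / 2 ^ (k + 1)) := by
    have : y = 1 / 4 * (t / 2 ^ (k + 1)) := by
      rw [hy, pow_add _ k 3, pow_add _ k 1]
      field_simp
      norm_num
    rw [this]
    gcongr
    linarith [Real.log_two_lt_d9]
  have hexp : t * 2 ^ (k + 1) ≤ Real.exp y := by
    refine le_trans ?_ (Real.quadratic_le_exp_of_nonneg hy0.le)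
    have h1 : t * 2 ^ (k + 1) ≤ y ^ 2 / 2 := by
      have h2 : y ^ 2 / 2 = t * (t / 2 ^ (2 * k + 7)) := by
        rw [hy, div_pow, ← pow_mul, show (k + 3) * 2 = 2 * k + 6 by ring, pow_succ 2 (2 * k + 6)]
        field_simp
      rw [h2]
      gcongr
      rw [le_div_iff₀ (by positivity), ← pow_add]
      exact (pow_le_pow_right₀ one_le_two (by lia)).trans ht'
    linarith
  calc t * Real.exp (-((1 - Real.log 2) * (t / 2 ^ (k + 1)))) ≤ t * Real.exp (-y) := by gcongr
    _ = t / Real.exp y := by rw [Real.exp_neg, div_eq_mul_inv]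
    _ ≤ t / (t * 2 ^ (k + 1)) := by gcongr
    _ = (1 / 2) ^ (k + 1) := by
      rw [one_div_pow]
      field_simp

/-- For every `k ≥ 1` there are `δ > 0` and `n₀ > 0` such that for all
`n, r, s, t` with `n₀ ≤ n`, `n+1 ≤ s ≤ t`, `r ≤ t ≤ 2^{δn}`, `n^k ≤ t`, and every
unsatisfiable CNF `F` of `r` clauses in `n` variables, every Res(k) refutation of
`R^kREF^F_{s,t}` has length greater than `2^{β(k)·t/n^{k-1}}`. -/
theorem rkref_resK_length_lower_bound (k : ℕ) (hk : 1 ≤ k) :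
    ∃ δ : ℝ, 0 < δ ∧ ∃ n₀ : ℕ, 0 < n₀ ∧
      ∀ n r s t : ℕ, ∀ Cm : ℕ → Clause ℕ,
        n₀ ≤ n → n + 1 ≤ s → s ≤ t → r ≤ t → (t : ℝ) ≤ (2 : ℝ) ^ (δ * (n : ℝ)) →
        n ^ k ≤ t →
        (∀ m ∈ Finset.Icc 1 r, ∀ l ∈ Cm m, l.var ∈ Finset.Icc 1 n) →
        Unsat {E : Clause ℕ | ∃ m ∈ Finset.Icc 1 r, E = Cm m} →
        ∀ P : List (Dnf RRefVar),
          IsResKRefutation k {E | RRefClause Cm n r s t k E} P →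
          (2 : ℝ) ^ (betaConst k * (t : ℝ) / (n : ℝ) ^ (k - 1)) < (P.length : ℝ) := by
  refine ⟨1 / 16, by norm_num, (2 * k + 3) * (2 ^ (k ^ 2 + 3 * k + 8) * k.factorial),
    by positivity, ?_⟩
  intro n r s t Cm hn₀ hns hst _ ht hnt _ hF P hP
  have hn₁ : (2 * k + 3) * 2 ^ (k ^ 2 + 3 * k + 8) ≤ n :=
    (Nat.mul_le_mul_left _ (Nat.le_mul_of_pos_right _ k.factorial_pos)).trans hn₀
  have hn : 1 ≤ n := le_trans (Nat.one_le_iff_ne_zero.2 (by positivity)) hn₁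
  have hnt' : n ≤ t := (Nat.le_self_pow (by lia) n).trans hnt
  have hak : (2 * k + 3 : ℝ) ≤ levelExponent k n t (k - 1) := by
    refine le_trans ?_ (le_levelExponent hk hn hnt)
    rw [le_div_iff₀ (by positivity)]
    exact_mod_cast hn₀
  have hone : ∀ i < k, 1 ≤ levelExponent k n t i := fun i hi =>
    le_trans (by linarith [(k.cast_nonneg : (0 : ℝ) ≤ k)])
      (hak.trans (levelExponent_anti k t hn (by lia)))
  let m : ℕ → ℕ := fun j => ⌈4 ^ j * levelExponent k n t (j - 1)⌉₊
  let ε : ℕ → ℝ := fun j => if j = 0 then 0 else 2 ^ (-levelExponent k n t (j - 1))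
  have hε : ∀ j, 0 ≤ ε j := fun j => by
    simp only [ε]
    split_ifs <;> positivity
  have hcover : ∀ j < k,
      ((answers n t).card : ℝ) ^ ((j + 1) * m (j + 1)) * ε j ≤ ε (j + 1) := by
    rintro (_ | i) hi
    · simpa [ε] using hε 1
    · simpa [ε, m, add_assoc, one_add_one_eq_two] using card_answers_pow_mul_le hn ht (hone _ hi)
  have hheight : 6 * (treeHeight m k : ℝ) ≤ t / 2 ^ (k + 1) := by
    have hh := treeHeight_ceil_le (k := k) (t := t) (m := m) hn (fun i => by simp [m]) (k - 1)
    rw [Nat.sub_add_cancel hk] at hh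
    push_cast [hk] at hh
    have hD : t / 2 ^ (k + 1) = 8 * (t / 2 ^ (k + 4) : ℝ) := by
      rw [pow_add _ k 4, pow_add _ k 1]
      field_simp
      norm_num
    have hkn : (6 * k : ℝ) ≤ n := by
      have : 6 * k ≤ (2 * k + 3) * 2 ^ (k ^ 2 + 3 * k + 8) := by
        have : 2 ^ 2 ≤ 2 ^ (k ^ 2 + 3 * k + 8) := Nat.pow_le_pow_right two_pos (by lia)
        nlinarith
      exact_mod_cast this.trans hn₁
    have hkD : (4 * k ^ 2 : ℝ) ≤ t / 2 ^ (k + 4) := by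
      rw [le_div_iff₀ (by positivity)]
      have h1 : 4 * k ^ 2 * 2 ^ (k + 4) ≤ 2 ^ (k ^ 2 + 3 * k + 8) := by
        calc 4 * k ^ 2 * 2 ^ (k + 4) ≤ 4 * 2 ^ (k ^ 2) * 2 ^ (k + 4) :=
              Nat.mul_le_mul_right _ (Nat.mul_le_mul_left _ Nat.lt_two_pow_self.le)
          _ = 2 ^ (k ^ 2 + k + 6) := by ring
          _ ≤ _ := Nat.pow_le_pow_right two_pos (by lia)
      have h2 : 2 ^ (k ^ 2 + 3 * k + 8) ≤ (2 * k + 3) * 2 ^ (k ^ 2 + 3 * k + 8) :=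
        Nat.le_mul_of_pos_left _ (by lia)
      exact_mod_cast h1.trans (h2.trans (hn₁.trans hnt'))
    set D : ℝ := t / 2 ^ (k + 4) with hDdef
    have hD0 : 0 ≤ D := by positivity
    have hkD' : ((k : ℝ) - 1) * (D / (2 * n)) ≤ D / 12 := by
      have hn0 : (0 : ℝ) < 2 * n := by positivity
      rw [← mul_div_assoc, div_le_iff₀ hn0]
      nlinarith
    rw [hD]
    norm_num at hh
    linarith
  have hmain := length_bound_of_heights hk hn hns hst hF hP m ε hε
    (fun j hj => by simpa [ε, m] using
      one_sub_pow_ceil_le (j := j) (levelExponent_nonneg k n t j)) hcover hheight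
  have htail : t * Real.exp (-((1 - Real.log 2) * (t / 2 ^ (k + 1)))) ≤ (1 / 2) ^ (k + 1) := by
    refine mul_exp_neg_le (le_trans ?_ (hn₁.trans hnt'))
    refine (Nat.pow_le_pow_right two_pos ?_).trans (Nat.le_mul_of_pos_left _ (by lia))
    lia
  by_contra! hlen
  have hεk : ε k = 2 ^ (-levelExponent k n t (k - 1)) := if_neg (by lia)
  have hP' : P.length * ε k < (1 / 2) ^ (k + 1) := by
    calc P.length * ε k
        ≤ 2 ^ (levelExponent k n t (k - 1) / 2) * 2 ^ (-levelExponent k n t (k - 1)) := by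
          rw [hεk]
          gcongr
          exact hlen.trans (Real.rpow_le_rpow_of_exponent_le one_le_two (betaConst_mul_le t hk hn))
      _ = (2 : ℝ) ^ (-(levelExponent k n t (k - 1) / 2)) := by
          rw [← Real.rpow_add two_pos]
          congr 1
          ring
      _ < 2 ^ (-((k + 1 : ℕ) : ℝ)) := by
          refine Real.rpow_lt_rpow_of_exponent_lt one_lt_two ?_
          push_cast
          linarith
      _ = (1 / 2) ^ (k + 1) := by
          rw [Real.rpow_neg two_pos.le, Real.rpow_natCast, one_div_pow, one_div]
  have : (1 / 2 : ℝ) ^ k = (1 / 2) ^ (k + 1) + (1 / 2) ^ (k + 1) := by ring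
  linarith
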